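/- arXiv:2412.19594 — 5 statements merged into one kernel-verified Lean document; each statement's English description precedes it below -/
import Mathlib

section
/- Let φ ∈ (1/2,1) be irrational and let m ∈ ℕ and F ⊆ ℕ be such that a configuration X ∈ {0,1}^ℤ belongs to G_St(φ) if and only if X contains no m consecutive 0's and no two 1's at a distance k ∈ F. Then for every summable function g : ℕ → (0,∞) there exists V : ℕ → [0,∞) with V(k) > 0 if and only if k ∈ F and V(k) ≤ g(k) for all k, such that for the non-frustrated Hamiltonian H with two-body terms V(j−i)·1[X(i) = X(j) = 1] for i < j and finite-range terms 1[X(i) = X(i+1) = ⋯ = X(i+m−1) = 0], every shift-invariant Borel probability measure on {0,1}^ℤ supported on the set of ground-state configurations of H is the unique shift-invariant probability measure supported on G_St(φ). -/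
open MeasureTheory

/-- The Sturmian sequence generated by an irrational `φ ∈ (0,1)`. -/
noncomputable def sturmian (φ : ℝ) : ℤ → Fin 2 :=
  fun n => if Int.fract ((n : ℝ) * φ) < φ then 0 else 1

/-- `G_St(φ)`: closure of the shift orbit of `X^φ` in the product topology. -/
noncomputable def GSt (φ : ℝ) : Set (ℤ → Fin 2) :=
  closure {Y | ∃ k : ℤ, Y = fun n => sturmian φ (n - k)}

/-- `Y` is a local excitation of `X`: they differ at finitely many sites. -/
def LocalExc (Y X : ℤ → Fin 2) : Prop := {i : ℤ | Y i ≠ X i}.Finite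

/-- Indicator of two particles (`1`'s) at sites `i < j`. -/
noncomputable def pairInd (X : ℤ → Fin 2) (p : ℤ × ℤ) : ℝ :=
  if X p.1 = 1 ∧ X p.2 = 1 then 1 else 0

/-- Indicator of `m` consecutive `0`'s starting at `i`. -/
noncomputable def zeroBlockInd (m : ℕ) (X : ℤ → Fin 2) (i : ℤ) : ℝ :=
  if ∀ j : ℕ, j < m → X (i + j) = 0 then 1 else 0

/-- Relative Hamiltonian `H(Y|X)` for the two-body interactions `V(j-i)·1[X(i)=X(j)=1]`
(for `i < j`) together with the finite-range terms `1[X(i)=⋯=X(i+m-1)=0]`. -/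
noncomputable def HRel (V : ℕ → ℝ) (m : ℕ) (Y X : ℤ → Fin 2) : ℝ :=
  (∑' p : ℤ × ℤ, if p.1 < p.2 then V (p.2 - p.1).toNat * (pairInd Y p - pairInd X p) else 0)
    + ∑ᶠ i : ℤ, (zeroBlockInd m Y i - zeroBlockInd m X i)

/-- `X` is a ground-state configuration of the Hamiltonian with couplings `V`, block size `m`. -/
noncomputable def IsGS (V : ℕ → ℝ) (m : ℕ) (X : ℤ → Fin 2) : Prop :=
  ∀ Y, LocalExc Y X → 0 ≤ HRel V m Y X

/-- `μ` is invariant under the shift `(T X)(n) = X(n-1)`. -/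
def ShiftInv (μ : Measure (ℤ → Fin 2)) : Prop :=
  Measure.map (fun X (n : ℤ) => X (n - 1)) μ = μ

section ShiftedPatterns

/-- The left shift on configurations, inverse to the shift in `ShiftInv`. -/
def siteShift (X : ℤ → Fin 2) : ℤ → Fin 2 := fun n => X (n + 1)

lemma siteShift_iterate (i : ℕ) (X : ℤ → Fin 2) : siteShift^[i] X = fun n => X (n + i) := by
  induction i generalizing X with
  | zero => simp
  | succ i ih =>
    rw [Function.iterate_succ_apply, ih]
    funext n
    simp only [siteShift]
    congr 1
    push_cast
    ring

lemma measurable_siteShift : Measurable siteShift :=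
  measurable_pi_lambda _ fun n => measurable_pi_apply (n + 1)

lemma ShiftInv.measurePreserving_siteShift {μ : Measure (ℤ → Fin 2)} (h : ShiftInv μ) :
    MeasurePreserving siteShift μ μ := by
  refine ⟨measurable_siteShift, ?_⟩
  have hT : Measurable fun (X : ℤ → Fin 2) (n : ℤ) => X (n - 1) :=
    measurable_pi_lambda _ fun n => measurable_pi_apply (n - 1)
  conv_lhs => rw [← show Measure.map (fun (X : ℤ → Fin 2) (n : ℤ) => X (n - 1)) μ = μ from h]
  rw [Measure.map_map measurable_siteShift hT]
  have : siteShift ∘ (fun (X : ℤ → Fin 2) (n : ℤ) => X (n - 1)) = id := by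
    funext X n
    simp [siteShift]
  rw [this, Measure.map_id]

/-- The number of `i < N` for which `X` shifted by `i` lies in `A`. -/
noncomputable def visitCount (A : Set (ℤ → Fin 2)) (N : ℕ) (X : ℤ → Fin 2) : ℝ :=
  ∑ i ∈ Finset.range N, A.indicator (fun _ => (1 : ℝ)) (siteShift^[i] X)

/-- Bounds on visit counts over a set of full outer measure bound the measure of the
visited set. -/
lemma measureReal_mem_Icc_of_visitCount {μ : Measure (ℤ → Fin 2)} [IsProbabilityMeasure μ]
    (hμ : ShiftInv μ) {A S : Set (ℤ → Fin 2)} (hA : MeasurableSet A) (hS : μ S = 1)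
    {N : ℕ} {a b : ℝ} (hab : ∀ X ∈ S, visitCount A N X ∈ Set.Icc a b) :
    N * μ.real A ∈ Set.Icc a b := by
  have hmp := hμ.measurePreserving_siteShift
  have hind : Measurable (A.indicator fun _ => (1 : ℝ)) := measurable_const.indicator hA
  have hmeas : Measurable (visitCount A N) :=
    Finset.measurable_fun_sum _ fun i _ => hind.comp (measurable_siteShift.iterate i)
  have hint (i : ℕ) : Integrable (fun X => A.indicator (fun _ => (1 : ℝ)) (siteShift^[i] X)) μ :=
    (hmp.iterate i).integrable_comp_of_integrable ((integrable_const 1).indicator hA)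
  have hval : ∫ X, visitCount A N X ∂μ = N * μ.real A := by
    simp only [visitCount]
    rw [integral_finsetSum _ fun i _ => hint i]
    have (i : ℕ) : ∫ X, A.indicator (fun _ => (1 : ℝ)) (siteShift^[i] X) ∂μ = μ.real A := by
      have h1 : (fun X => A.indicator (fun _ => (1 : ℝ)) (siteShift^[i] X)) =
          (siteShift^[i] ⁻¹' A).indicator 1 := by
        funext X
        rfl
      rw [h1, integral_indicator_one (measurable_siteShift.iterate i hA), measureReal_def,
        (hmp.iterate i).measure_preimage hA.nullMeasurableSet, measureReal_def]
    simp [this]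
  have hae : ∀ᵐ X ∂μ, visitCount A N X ∈ Set.Icc a b := by
    have hm : MeasurableSet {X | visitCount A N X ∈ Set.Icc a b} := hmeas measurableSet_Icc
    have h1 : μ {X | visitCount A N X ∈ Set.Icc a b} = 1 :=
      le_antisymm prob_le_one (hS ▸ measure_mono hab)
    exact (mem_ae_iff_prob_eq_one hm).2 h1
  have hI : Integrable (visitCount A N) μ := integrable_finsetSum _ fun i _ => hint i
  constructor
  · have := integral_mono_ae (integrable_const a) hI (hae.mono fun X hX => hX.1)
    simpa [hval] using this
  · have := integral_mono_ae hI (integrable_const b) (hae.mono fun X hX => hX.2)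
    simpa [hval] using this

end ShiftedPatterns

section Rotation

lemma Irrational.exists_pos_le_abs_natCast_mul_sub {φ : ℝ} (hφ : Irrational φ) (q : ℕ) :
    ∃ δ > 0, ∀ j : ℕ, 0 < j → j < q → ∀ z : ℤ, δ ≤ |j * φ - z| := by
  induction q with
  | zero => exact ⟨1, one_pos, fun j _ h => by omega⟩
  | succ q ih =>
    obtain ⟨δ, hδ, h⟩ := ih
    rcases Nat.eq_zero_or_pos q with rfl | hq
    · exact ⟨1, one_pos, fun j _ _ => by omega⟩
    have hne : (q : ℝ) * φ - round ((q : ℝ) * φ) ≠ 0 :=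
      sub_ne_zero.2 ((hφ.natCast_mul hq.ne').ne_int _)
    refine ⟨min δ |(q : ℝ) * φ - round ((q : ℝ) * φ)|, lt_min hδ (abs_pos.2 hne), ?_⟩
    intro j hj hjq z
    rcases (Nat.lt_succ_iff.1 hjq).lt_or_eq with hlt | rfl
    · exact (min_le_left _ _).trans (h j hj hlt z)
    · exact (min_le_right _ _).trans (round_le _ z)

/-- An orbit of the rotation visits a short arc at most once in every `q` steps. -/
lemma card_visits_le {φ δ : ℝ} {q : ℕ} (hq : 0 < q)
    (h : ∀ j : ℕ, 0 < j → j < q → ∀ z : ℤ, 2 * δ ≤ |j * φ - z|) (c : ℝ) (N : ℕ)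
    (T : Finset ℕ) (hTN : T ⊆ Finset.range N) (hT : ∀ n ∈ T, ∃ z : ℤ, |c + n * φ - z| < δ) :
    T.card ≤ N / q + 1 := by
  have key : ∀ a ∈ T, ∀ b ∈ T, a < b → a / q ≠ b / q := by
    intro a ha b hb hab hq'
    obtain ⟨y, hy⟩ := hT a ha
    obtain ⟨z, hz⟩ := hT b hb
    have hlt : b - a < q := by
      have h1 := Nat.div_add_mod a q
      have h2 := Nat.div_add_mod b q
      have h3 := Nat.mod_lt b hq
      rw [hq'] at h1
      omega
    have := h (b - a) (by omega) hlt (z - y)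
    rw [Nat.cast_sub hab.le] at this
    push_cast at this
    rw [abs_lt] at hy hz
    have h2 : |((b : ℝ) - a) * φ - (z - y)| < 2 * δ := by
      rw [abs_lt]
      constructor <;> linarith
    linarith
  calc T.card ≤ (Finset.range (N / q + 1)).card := by
        refine Finset.card_le_card_of_injOn (fun n => n / q) ?_ ?_
        · intro n hn
          have hnN := Finset.mem_range.1 (hTN hn)
          have := Nat.div_le_div_right (c := q) hnN.le
          simp only [Finset.coe_range, Set.mem_Iio]
          omega
        · intro a ha b hb hab
          by_contra hne
          rcases lt_or_gt_of_ne hne with hlt | hlt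
          · exact key a ha b hb hlt hab
          · exact key b hb a ha hlt hab.symm
    _ = N / q + 1 := Finset.card_range _

lemma Irrational.exists_bound_abs_add_intCast_mul_sub_lt {φ : ℝ} (hφ : Irrational φ) {δ : ℝ}
    (hδ : 0 < δ) :
    ∃ K : ℕ, ∀ x : ℝ, ∃ k : ℤ, |k| ≤ K ∧ ∃ z : ℤ, |x - k * φ - z| < δ := by
  obtain ⟨n, hn⟩ := exists_nat_one_div_lt hδ
  obtain ⟨j, k, hk, -, hjk⟩ := Real.exists_int_int_abs_mul_sub_le φ (Nat.succ_pos n)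
  set θ : ℝ := k * φ - j with hθ
  have hθ0 : θ ≠ 0 := sub_ne_zero.2 ((hφ.intCast_mul hk.ne').ne_int _)
  have hθδ : |θ| < δ := by
    refine hjk.trans_lt (lt_of_le_of_lt ?_ hn)
    apply one_div_le_one_div_of_le <;> push_cast <;> linarith [(n.cast_nonneg : (0 : ℝ) ≤ n)]
  refine ⟨(⌈1 / |θ|⌉₊ + 1) * k.toNat, fun x => ?_⟩
  set y := Int.fract x with hy
  set t := ⌊y / θ⌋ with ht
  have hyt : |y - t * θ| < |θ| := by
    have h1 : y - t * θ = θ * Int.fract (y / θ) := by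
      rw [← Int.self_sub_floor]
      field_simp
      ring
    rw [h1, abs_mul, abs_of_nonneg (Int.fract_nonneg (y / θ))]
    exact mul_lt_of_lt_one_right (abs_pos.2 hθ0) (Int.fract_lt_one _)
  have htb : |t| ≤ (⌈1 / |θ|⌉₊ + 1 : ℕ) := by
    have h0 : |y / θ| ≤ 1 / |θ| := by
      rw [abs_div, abs_of_nonneg (Int.fract_nonneg x : 0 ≤ y)]
      exact div_le_div_of_nonneg_right (Int.fract_lt_one x).le (abs_nonneg θ)
    have h1 : |y / θ| ≤ ⌈1 / |θ|⌉₊ := h0.trans (Nat.le_ceil _)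
    have h2 : (t : ℝ) ≤ y / θ := Int.floor_le _
    have h3 : y / θ < t + 1 := Int.lt_floor_add_one _
    rw [abs_le] at h1
    have : |(t : ℝ)| ≤ ⌈1 / |θ|⌉₊ + 1 := by
      rw [abs_le]
      constructor <;> linarith
    exact_mod_cast this
  refine ⟨t * k, ?_, ⌊x⌋ - t * j, ?_⟩
  · rw [abs_mul, abs_of_pos hk]
    push_cast
    rw [Int.toNat_of_nonneg hk.le]
    have := mul_le_mul_of_nonneg_right htb hk.le
    push_cast at this
    exact this
  · have h1 : x - ((t * k : ℤ) : ℝ) * φ - ((⌊x⌋ - t * j : ℤ) : ℝ) = y - t * θ := by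
      rw [hy, hθ, ← Int.self_sub_floor]
      push_cast
      ring
    rw [h1]
    exact hyt.trans hθδ

/-- Two Sturmian symbols at nearby phases differ only close to the endpoints of the coding
interval. -/
lemma exists_abs_lt_of_sturmian_ne {φ δ : ℝ} {u v z : ℤ}
    (hz : |((v : ℝ) - u) * φ - z| < δ) (hne : sturmian φ u ≠ sturmian φ v) :
    (∃ y : ℤ, |u * φ - y| < δ) ∨ ∃ y : ℤ, |u * φ - φ - y| < δ := by
  by_contra! hcon
  obtain ⟨h1, h2⟩ := hcon
  have ha := h1 ⌊(u : ℝ) * φ⌋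
  have hb := h1 (⌊(u : ℝ) * φ⌋ + 1)
  have hc := h2 ⌊(u : ℝ) * φ⌋
  set f := Int.fract ((u : ℝ) * φ) with hf
  have hfu : (u : ℝ) * φ = ⌊(u : ℝ) * φ⌋ + f := (Int.floor_add_fract _).symm
  have hf0 : 0 ≤ f := Int.fract_nonneg _
  have hf1 : f < 1 := Int.fract_lt_one _
  set e := ((v : ℝ) - u) * φ - z with he
  obtain ⟨he1, he2⟩ := abs_lt.1 hz
  have ha' : δ ≤ f := by
    rwa [show (u : ℝ) * φ - ⌊(u : ℝ) * φ⌋ = f by linarith, abs_of_nonneg hf0] at ha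
  have hb' : δ ≤ 1 - f := by
    push_cast at hb
    rwa [show (u : ℝ) * φ - (⌊(u : ℝ) * φ⌋ + 1) = -(1 - f) by linarith, abs_neg,
      abs_of_nonneg (by linarith)] at hb
  rw [show (u : ℝ) * φ - φ - ⌊(u : ℝ) * φ⌋ = f - φ by linarith] at hc
  have hfv : Int.fract ((v : ℝ) * φ) = f + e := by
    rw [Int.fract_eq_iff]
    refine ⟨by linarith, by linarith, ⌊(u : ℝ) * φ⌋ + z, ?_⟩
    push_cast
    rw [he]
    linarith
  apply hne
  have hiff : f < φ ↔ f + e < φ := by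
    rcases le_abs.1 hc with h | h <;> constructor <;> intro <;> linarith
  simp only [sturmian, hfv, ← hf, hiff]

/-- Any two windows of the Sturmian sequence become nearly equal after a bounded translation. -/
lemma exists_bound_card_sturmian_ne_le {φ : ℝ} (hφ : Irrational φ) {ε : ℝ} (hε : 0 < ε) :
    ∃ K : ℕ, ∀ s t : ℤ, ∃ k : ℤ, |k| ≤ K ∧ ∀ (i : ℤ) (N : ℕ),
      (((Finset.range N).filter fun n : ℕ =>
        sturmian φ (i + (s + n)) ≠ sturmian φ (i + (t + k + n))).card : ℝ) ≤ ε * N + 2 := by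
  obtain ⟨q, hq⟩ := exists_nat_gt (2 / ε)
  have hq0 : (0 : ℝ) < q := (by positivity : 0 < 2 / ε).trans hq
  have hq0' : 0 < q := by exact_mod_cast hq0
  obtain ⟨δ', hδ', hsep⟩ := hφ.exists_pos_le_abs_natCast_mul_sub q
  set δ := δ' / 2 with hδ
  have hsep' : ∀ j : ℕ, 0 < j → j < q → ∀ z : ℤ, 2 * δ ≤ |j * φ - z| := by
    intro j hj hjq z
    have := hsep j hj hjq z
    linarith
  obtain ⟨K, hK⟩ := hφ.exists_bound_abs_add_intCast_mul_sub_lt (half_pos hδ')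
  refine ⟨K, fun s t => ?_⟩
  obtain ⟨k, hk, z, hz⟩ := hK ((s - t : ℝ) * φ)
  refine ⟨k, hk, fun i N => ?_⟩
  set T := (Finset.range N).filter fun n : ℕ =>
    sturmian φ (i + (s + n)) ≠ sturmian φ (i + (t + k + n)) with hT
  classical
  set T₁ := T.filter fun n : ℕ => ∃ y : ℤ, |((i : ℝ) + s) * φ + n * φ - y| < δ with hT₁
  set T₂ := T.filter fun n : ℕ => ∃ y : ℤ, |((i : ℝ) + s - 1) * φ + n * φ - y| < δ with hT₂
  have hsub : T ⊆ T₁ ∪ T₂ := by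
    intro n hn
    have hne := (Finset.mem_filter.1 hn).2
    have hz' : |(((i + (t + k + n) : ℤ) : ℝ) - (i + (s + n) : ℤ)) * φ - (-z : ℤ)| < δ := by
      rw [← abs_neg]
      convert hz using 2
      push_cast
      ring
    rcases exists_abs_lt_of_sturmian_ne hz' hne with ⟨y, hy⟩ | ⟨y, hy⟩
    · refine Finset.mem_union_left _ (Finset.mem_filter.2 ⟨hn, y, ?_⟩)
      convert hy using 2
      push_cast
      ring
    · refine Finset.mem_union_right _ (Finset.mem_filter.2 ⟨hn, y, ?_⟩)
      convert hy using 2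
      push_cast
      ring
  have hTN : T ⊆ Finset.range N := Finset.filter_subset _ _
  have h1 : T₁.card ≤ N / q + 1 := card_visits_le hq0' hsep' _ N T₁
    ((Finset.filter_subset _ _).trans hTN) fun n hn => (Finset.mem_filter.1 hn).2
  have h2 : T₂.card ≤ N / q + 1 := card_visits_le hq0' hsep' _ N T₂
    ((Finset.filter_subset _ _).trans hTN) fun n hn => (Finset.mem_filter.1 hn).2
  have h3 : T.card ≤ 2 * (N / q) + 2 :=
    (Finset.card_le_card hsub).trans ((Finset.card_union_le _ _).trans (by omega))
  have h4 : ((N / q : ℕ) : ℝ) ≤ N / q := Nat.cast_div_le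
  have h5 : (2 : ℝ) * (N / q) ≤ ε * N := by
    rw [← mul_div_assoc, div_le_iff₀ hq0]
    have : 2 ≤ ε * q := by
      rw [div_lt_iff₀ hε] at hq
      linarith
    nlinarith [(N.cast_nonneg : (0 : ℝ) ≤ N)]
  have h6 : (T.card : ℝ) ≤ 2 * ((N / q : ℕ) : ℝ) + 2 := by exact_mod_cast h3
  linarith

end Rotation

section UniqueErgodicity

/-- Membership in `A` depends only on the coordinates in the finite set `I`. -/
def DependsOnSites (A : Set (ℤ → Fin 2)) (I : Finset ℤ) : Prop :=
  ∀ X Y : ℤ → Fin 2, (∀ i ∈ I, X i = Y i) → (X ∈ A ↔ Y ∈ A)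

lemma visitCount_eq_card (A : Set (ℤ → Fin 2)) (N : ℕ) (X : ℤ → Fin 2)
    [DecidablePred fun n : ℕ => (fun i : ℤ => X (i + n)) ∈ A] :
    visitCount A N X =
      ((Finset.range N).filter fun n : ℕ => (fun i : ℤ => X (i + n)) ∈ A).card := by
  classical
  rw [Finset.card_filter]
  push_cast
  refine Finset.sum_congr rfl fun n _ => ?_
  rw [siteShift_iterate, Set.indicator_apply]

lemma visitCount_translate_le (A : Set (ℤ → Fin 2)) (X : ℤ → Fin 2) (N : ℕ) (t k : ℤ) :
    visitCount A N (fun i => X (i + (t + k))) ≤ visitCount A N (fun i => X (i + t)) + |k| := by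
  classical
  set P : ℤ → Prop := fun v => (fun i : ℤ => X (i + v)) ∈ A with hP
  have hcount (u : ℤ) : visitCount A N (fun i => X (i + u)) =
      ((Finset.Ico u (u + N)).filter P).card := by
    rw [visitCount_eq_card, Nat.cast_inj]
    refine Finset.card_bij (fun n _ => u + (n : ℤ)) ?_ ?_ ?_
    · intro n hn
      simp only [Finset.mem_filter, Finset.mem_range, Finset.mem_Ico, hP] at hn ⊢
      refine ⟨by omega, ?_⟩
      convert hn.2 using 3
      ring
    · intro a _ b _ h
      simpa using h
    · intro v hv
      simp only [Finset.mem_filter, Finset.mem_range, Finset.mem_Ico, hP] at hv ⊢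
      refine ⟨(v - u).toNat, ⟨by omega, ?_⟩, by omega⟩
      convert hv.2 using 3
      omega
  rw [hcount, hcount]
  have hsub : (Finset.Ico (t + k) (t + k + N)).filter P ⊆
      (Finset.Ico t (t + N)).filter P ∪
        (Finset.Ico (t + k) t ∪ Finset.Ico (t + N) (t + k + N)) := by
    intro v hv
    simp only [Finset.mem_filter, Finset.mem_union, Finset.mem_Ico] at hv ⊢
    by_cases h : t ≤ v ∧ v < t + N
    · exact Or.inl ⟨h, hv.2⟩
    · right
      omega
  have h1 := (Finset.card_le_card hsub).trans ((Finset.card_union_le _ _).trans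
    (Nat.add_le_add_left (Finset.card_union_le _ _) _))
  rw [Int.card_Ico, Int.card_Ico] at h1
  have h2 : (((Finset.Ico (t + k) (t + k + N)).filter P).card : ℤ) ≤
      ((Finset.Ico t (t + N)).filter P).card + |k| := by
    rcases abs_cases k with h | h <;> omega
  exact_mod_cast h2

lemma visitCount_le_add_sum_card {A : Set (ℤ → Fin 2)} {I : Finset ℤ} (hA : DependsOnSites A I)
    (X Y : ℤ → Fin 2) (N : ℕ) :
    visitCount A N X ≤ visitCount A N Y +
      ∑ i ∈ I, (((Finset.range N).filter fun n : ℕ => X (i + n) ≠ Y (i + n)).card : ℝ) := by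
  classical
  rw [visitCount_eq_card, visitCount_eq_card]
  have hsub : ((Finset.range N).filter fun n : ℕ => (fun i : ℤ => X (i + n)) ∈ A) ⊆
      ((Finset.range N).filter fun n : ℕ => (fun i : ℤ => Y (i + n)) ∈ A) ∪
        I.biUnion fun i => (Finset.range N).filter fun n : ℕ => X (i + n) ≠ Y (i + n) := by
    intro n hn
    rw [Finset.mem_filter] at hn
    by_cases h : ∀ i ∈ I, X (i + n) = Y (i + n)
    · exact Finset.mem_union_left _ (Finset.mem_filter.2 ⟨hn.1, (hA _ _ h).1 hn.2⟩)
    · push Not at h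
      obtain ⟨i, hi, hne⟩ := h
      exact Finset.mem_union_right _
        (Finset.mem_biUnion.2 ⟨i, hi, Finset.mem_filter.2 ⟨hn.1, hne⟩⟩)
  have h1 := (Finset.card_le_card hsub).trans ((Finset.card_union_le _ _).trans
    (Nat.add_le_add_left Finset.card_biUnion_le _))
  exact_mod_cast h1

lemma visitCount_congr {A : Set (ℤ → Fin 2)} {I : Finset ℤ} (hA : DependsOnSites A I)
    {X Y : ℤ → Fin 2} {N : ℕ} (h : ∀ i ∈ I, ∀ n < N, X (i + (n : ℤ)) = Y (i + (n : ℤ))) :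
    visitCount A N X = visitCount A N Y := by
  classical
  refine Finset.sum_congr rfl fun n hn => ?_
  have := hA (siteShift^[n] X) (siteShift^[n] Y) fun i hi => by
    rw [siteShift_iterate, siteShift_iterate]
    exact h i hi n (Finset.mem_range.1 hn)
  simp only [Set.indicator_apply, this]

lemma exists_eq_sturmian_of_mem_GSt {φ : ℝ} {Y : ℤ → Fin 2} (hY : Y ∈ GSt φ) (J : Finset ℤ) :
    ∃ s : ℤ, ∀ i ∈ J, Y i = sturmian φ (i + s) := by
  have hopen : IsOpen {Z : ℤ → Fin 2 | ∀ i ∈ J, Z i = Y i} := by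
    have : {Z : ℤ → Fin 2 | ∀ i ∈ J, Z i = Y i} = Set.pi (J : Set ℤ) fun i => {Y i} := by
      ext Z
      simp [Set.mem_pi]
    rw [this]
    exact isOpen_set_pi J.finite_toSet fun i _ => isOpen_discrete _
  obtain ⟨Z, hZ, k, rfl⟩ := mem_closure_iff.1 hY _ hopen fun i _ => rfl
  exact ⟨-k, fun i hi => (hZ i hi).symm⟩

/-- Visit counts of a local pattern are asymptotically the same along all elements of `GSt φ`. -/
lemma exists_bound_visitCount_sub_le {φ : ℝ} (hφ : Irrational φ) {A : Set (ℤ → Fin 2)}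
    {I : Finset ℤ} (hA : DependsOnSites A I) {ε : ℝ} (hε : 0 < ε) :
    ∃ C : ℝ, ∀ (N : ℕ), ∀ X ∈ GSt φ, ∀ Y ∈ GSt φ,
      visitCount A N X ≤ visitCount A N Y + (ε * N + C) := by
  have hε' : 0 < ε / (I.card + 1) := by positivity
  obtain ⟨K, hK⟩ := exists_bound_card_sturmian_ne_le hφ hε'
  refine ⟨I.card * 2 + K, fun N X hX Y hY => ?_⟩
  set J : Finset ℤ := (I ×ˢ Finset.range N).image fun p => p.1 + (p.2 : ℤ) with hJ
  have hmem {i : ℤ} (hi : i ∈ I) {n : ℕ} (hn : n < N) : i + (n : ℤ) ∈ J :=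
    Finset.mem_image.2 ⟨(i, n), Finset.mem_product.2 ⟨hi, Finset.mem_range.2 hn⟩, rfl⟩
  obtain ⟨s, hs⟩ := exists_eq_sturmian_of_mem_GSt hX J
  obtain ⟨t, ht⟩ := exists_eq_sturmian_of_mem_GSt hY J
  rw [visitCount_congr hA (Y := fun i => sturmian φ (i + s)) fun i hi n hn => hs _ (hmem hi hn),
    visitCount_congr hA (X := Y) (Y := fun i => sturmian φ (i + t))
      fun i hi n hn => ht _ (hmem hi hn)]
  obtain ⟨k, hk, hcard⟩ := hK s t
  have h1 := visitCount_le_add_sum_card hA (fun i => sturmian φ (i + s))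
    (fun i => sturmian φ (i + (t + k))) N
  have h2 := visitCount_translate_le A (sturmian φ) N t k
  have h3 : ∑ i ∈ I, (((Finset.range N).filter fun n : ℕ =>
      sturmian φ (i + n + s) ≠ sturmian φ (i + n + (t + k))).card : ℝ) ≤
      ∑ i ∈ I, (ε / (I.card + 1) * N + 2) := by
    refine Finset.sum_le_sum fun i _ => ?_
    refine le_trans (le_of_eq ?_) (hcard i N)
    have e1 (n : ℕ) : i + (n : ℤ) + s = i + (s + n) := by ring
    have e2 (n : ℕ) : i + (n : ℤ) + (t + k) = i + (t + k + n) := by ring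
    simp only [e1, e2]
  rw [Finset.sum_const, nsmul_eq_mul] at h3
  have h4 : (I.card : ℝ) * (ε / (I.card + 1) * N) ≤ ε * N := by
    rw [← mul_assoc]
    refine mul_le_mul_of_nonneg_right ?_ N.cast_nonneg
    rw [← mul_div_assoc, div_le_iff₀ (by positivity)]
    nlinarith [(I.card.cast_nonneg : (0 : ℝ) ≤ I.card)]
  have h5 : ((|k| : ℤ) : ℝ) ≤ K := by exact_mod_cast hk
  push_cast at h5 h2
  linarith

lemma sturmian_mem_GSt (φ : ℝ) : sturmian φ ∈ GSt φ :=
  subset_closure ⟨0, by simp⟩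

/-- Two shift-invariant probability measures supported on `GSt φ` coincide. -/
lemma eq_of_measure_GSt_eq_one {φ : ℝ} (hφ : Irrational φ) {μ ν : Measure (ℤ → Fin 2)}
    [IsProbabilityMeasure μ] [IsProbabilityMeasure ν] (hμ : ShiftInv μ) (hν : ShiftInv ν)
    (hμG : μ (GSt φ) = 1) (hνG : ν (GSt φ) = 1) : ν = μ := by
  refine ext_of_generate_finite (measurableCylinders fun _ : ℤ => Fin 2)
    (generateFrom_measurableCylinders (α := fun _ : ℤ => Fin 2)).symm
    isPiSystem_measurableCylinders ?_ (by simp)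
  intro A hA
  obtain ⟨I, B, -, rfl⟩ := (mem_measurableCylinders _).1 hA
  have hmeas : MeasurableSet (cylinder I B) := MeasurableSet.of_mem_measurableCylinders
    (α := fun _ : ℤ => Fin 2) hA
  have hdep : DependsOnSites (cylinder I B) I := by
    intro X Y h
    rw [mem_cylinder, mem_cylinder]
    have : I.restrict X = I.restrict Y := funext fun i => h i i.2
    rw [this]
  suffices ν.real (cylinder I B) = μ.real (cylinder I B) by
    rwa [measureReal_def, measureReal_def,
      ENNReal.toReal_eq_toReal_iff' (measure_ne_top _ _) (measure_ne_top _ _)] at this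
  refine eq_of_abs_sub_le_all fun ε hε => ?_
  obtain ⟨C, hC⟩ := exists_bound_visitCount_sub_le hφ hdep (ε := ε / 4) (by positivity)
  obtain ⟨N, hN⟩ := exists_nat_gt (4 * |C| / ε)
  have hN0 : (0 : ℝ) < N := (by positivity : 0 ≤ 4 * |C| / ε).trans_lt hN
  have hCN : C ≤ ε / 4 * N := by
    rw [div_lt_iff₀ hε] at hN
    linarith [le_abs_self C]
  have hbd : ∀ X ∈ GSt φ, visitCount (cylinder I B) N X ∈
      Set.Icc (visitCount (cylinder I B) N (sturmian φ) - (ε / 4 * N + C))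
        (visitCount (cylinder I B) N (sturmian φ) + (ε / 4 * N + C)) := by
    intro X hX
    have h1 := hC N X hX _ (sturmian_mem_GSt φ)
    have h2 := hC N _ (sturmian_mem_GSt φ) X hX
    exact ⟨by linarith, h1⟩
  obtain ⟨h1, h2⟩ := measureReal_mem_Icc_of_visitCount hμ hmeas hμG hbd
  obtain ⟨h3, h4⟩ := measureReal_mem_Icc_of_visitCount hν hmeas hνG hbd
  rw [abs_le]
  constructor <;> refine le_of_mul_le_mul_left ?_ hN0 <;> nlinarith

end UniqueErgodicity

section WindowEnergy

/-- The tail `∑_{k ≥ n} V k` of the couplings. -/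
noncomputable def couplingTail (V : ℕ → ℝ) (n : ℕ) : ℝ := ∑' k, V (k + n)

lemma hasSum_rightwards_coupling {V : ℕ → ℝ} (hV : Summable V) (N i : ℕ) (hi : i < N) :
    HasSum (fun p : ℤ × ℤ => if p.1 = i ∧ (N : ℤ) ≤ p.2 then V (p.2 - p.1).toNat else 0)
      (couplingTail V (N - i)) := by
  have hinj : Function.Injective fun k : ℕ => ((i : ℤ), (N : ℤ) + k) := by
    intro a b h
    simpa using h
  rw [← hinj.hasSum_iff]
  · refine (((summable_nat_add_iff (N - i)).2 hV).hasSum).congr_fun ?_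
    intro k
    simp only [Function.comp]
    rw [if_pos ⟨trivial, by omega⟩]
    congr 1
    omega
  · rintro ⟨a, b⟩ hp
    refine if_neg fun h => hp ⟨(b - N).toNat, ?_⟩
    obtain ⟨h1, h2⟩ := h
    simp only at h1 h2
    simp only [Prod.mk.injEq]
    omega

lemma hasSum_leftwards_coupling {V : ℕ → ℝ} (hV : Summable V) (i : ℕ) :
    HasSum (fun p : ℤ × ℤ => if p.2 = i ∧ p.1 < 0 then V (p.2 - p.1).toNat else 0)
      (couplingTail V (i + 1)) := by
  have hinj : Function.Injective fun k : ℕ => (-1 - (k : ℤ), (i : ℤ)) := by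
    intro a b h
    simpa using h
  rw [← hinj.hasSum_iff]
  · refine (((summable_nat_add_iff (i + 1)).2 hV).hasSum).congr_fun ?_
    intro k
    simp only [Function.comp]
    rw [if_pos ⟨trivial, by omega⟩]
    congr 1
    omega
  · rintro ⟨a, b⟩ hp
    refine if_neg fun h => hp ⟨(-1 - a).toNat, ?_⟩
    obtain ⟨h1, h2⟩ := h
    simp only at h1 h2
    simp only [Prod.mk.injEq]
    omega

/-- Replace the window `[0, N)` of `X` by that of `Z`. -/
def patch (N : ℕ) (Z X : ℤ → Fin 2) : ℤ → Fin 2 :=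
  fun i => if 0 ≤ i ∧ i < N then Z i else X i

lemma patch_of_mem {N : ℕ} {Z X : ℤ → Fin 2} {i : ℤ} (h : 0 ≤ i ∧ i < N) :
    patch N Z X i = Z i := if_pos h

lemma patch_of_notMem {N : ℕ} {Z X : ℤ → Fin 2} {i : ℤ} (h : ¬ (0 ≤ i ∧ i < N)) :
    patch N Z X i = X i := if_neg h

lemma localExc_patch (N : ℕ) (Z X : ℤ → Fin 2) : LocalExc (patch N Z X) X := by
  refine (Set.finite_Ico (0 : ℤ) N).subset fun i hi => ?_
  by_contra h
  exact hi (patch_of_notMem h)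

lemma pairInd_nonneg (X : ℤ → Fin 2) (p : ℤ × ℤ) : 0 ≤ pairInd X p := by
  unfold pairInd
  split_ifs <;> norm_num

lemma pairInd_le_one (X : ℤ → Fin 2) (p : ℤ × ℤ) : pairInd X p ≤ 1 := by
  unfold pairInd
  split_ifs <;> norm_num

lemma zeroBlockInd_nonneg (m : ℕ) (X : ℤ → Fin 2) (i : ℤ) : 0 ≤ zeroBlockInd m X i := by
  unfold zeroBlockInd
  split_ifs <;> norm_num

lemma zeroBlockInd_le_one (m : ℕ) (X : ℤ → Fin 2) (i : ℤ) : zeroBlockInd m X i ≤ 1 := by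
  unfold zeroBlockInd
  split_ifs <;> norm_num

/-- The interaction energy of `X` carried by the pair `p`. -/
noncomputable def pairEnergy (V : ℕ → ℝ) (X : ℤ → Fin 2) (p : ℤ × ℤ) : ℝ :=
  if p.1 < p.2 then V (p.2 - p.1).toNat * pairInd X p else 0

lemma pairEnergy_nonneg {V : ℕ → ℝ} (hV0 : ∀ k, 0 ≤ V k) (X : ℤ → Fin 2) (p : ℤ × ℤ) :
    0 ≤ pairEnergy V X p := by
  unfold pairEnergy
  split_ifs
  · exact mul_nonneg (hV0 _) (pairInd_nonneg _ _)
  · exact le_rfl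

lemma pairEnergy_congr {V : ℕ → ℝ} {X Y : ℤ → Fin 2} {p : ℤ × ℤ} (h1 : X p.1 = Y p.1)
    (h2 : X p.2 = Y p.2) : pairEnergy V X p = pairEnergy V Y p := by
  simp only [pairEnergy, pairInd, h1, h2]

lemma pairEnergy_le {V : ℕ → ℝ} (hV0 : ∀ k, 0 ≤ V k) (X : ℤ → Fin 2) {p : ℤ × ℤ} :
    pairEnergy V X p ≤ if p.1 < p.2 then V (p.2 - p.1).toNat else 0 := by
  unfold pairEnergy
  split_ifs
  · exact mul_le_of_le_one_right (hV0 _) (pairInd_le_one _ _)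
  · exact le_rfl

/-- Patching a window with a configuration free of pair energy gains the pair energy inside the
window, up to boundary terms. -/
lemma tsum_pairEnergy_patch_le {V : ℕ → ℝ} (hV0 : ∀ k, 0 ≤ V k) (hV : Summable V)
    {Z : ℤ → Fin 2} (hZ : ∀ p, pairEnergy V Z p = 0) (X : ℤ → Fin 2) (N : ℕ) :
    ∑' p : ℤ × ℤ, (pairEnergy V (patch N Z X) p - pairEnergy V X p) ≤
      2 * ∑ i ∈ Finset.range N, couplingTail V (i + 1) -
        ∑ p ∈ Finset.Ico (0 : ℤ) N ×ˢ Finset.Ico (0 : ℤ) N, pairEnergy V X p := by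
  set W := Finset.Ico (0 : ℤ) N ×ˢ Finset.Ico (0 : ℤ) N with hW
  set r : ℤ × ℤ → ℝ := fun p => ∑ i ∈ Finset.range N,
    if p.1 = i ∧ (N : ℤ) ≤ p.2 then V (p.2 - p.1).toNat else 0 with hr
  set l : ℤ × ℤ → ℝ := fun p => ∑ i ∈ Finset.range N,
    if p.2 = i ∧ p.1 < 0 then V (p.2 - p.1).toNat else 0 with hl
  set d : ℤ × ℤ → ℝ := fun p => if p ∈ W then pairEnergy V X p else 0 with hd
  have hrs : HasSum r (∑ i ∈ Finset.range N, couplingTail V (N - i)) :=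
    hasSum_sum fun i hi => hasSum_rightwards_coupling hV N i (Finset.mem_range.1 hi)
  have hls : HasSum l (∑ i ∈ Finset.range N, couplingTail V (i + 1)) :=
    hasSum_sum fun i _ => hasSum_leftwards_coupling hV i
  have hds : HasSum d (∑ p ∈ W, pairEnergy V X p) := by
    have h : HasSum d (∑ p ∈ W, d p) := hasSum_sum_of_ne_finset_zero fun p hp => if_neg hp
    rwa [Finset.sum_congr rfl fun p hp => if_pos hp] at h
  have hr0 (p : ℤ × ℤ) : 0 ≤ r p := Finset.sum_nonneg fun i _ => by
    split_ifs
    exacts [hV0 _, le_rfl]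
  have hl0 (p : ℤ × ℤ) : 0 ≤ l p := Finset.sum_nonneg fun i _ => by
    split_ifs
    exacts [hV0 _, le_rfl]
  have hr1 {p : ℤ × ℤ} (h1 : 0 ≤ p.1 ∧ p.1 < N) (h2 : (N : ℤ) ≤ p.2) :
      V (p.2 - p.1).toNat ≤ r p := by
    have := Finset.single_le_sum (f := fun i : ℕ =>
      if p.1 = i ∧ (N : ℤ) ≤ p.2 then V (p.2 - p.1).toNat else 0) (s := Finset.range N)
      (fun i _ => by
        split_ifs
        exacts [hV0 _, le_rfl]) (Finset.mem_range.2 (by omega : p.1.toNat < N))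
    rwa [if_pos ⟨by omega, h2⟩] at this
  have hl1 {p : ℤ × ℤ} (h1 : 0 ≤ p.2 ∧ p.2 < N) (h2 : p.1 < 0) :
      V (p.2 - p.1).toNat ≤ l p := by
    have := Finset.single_le_sum (f := fun i : ℕ =>
      if p.2 = i ∧ p.1 < 0 then V (p.2 - p.1).toNat else 0) (s := Finset.range N)
      (fun i _ => by
        split_ifs
        exacts [hV0 _, le_rfl]) (Finset.mem_range.2 (by omega : p.2.toNat < N))
    rwa [if_pos ⟨by omega, h2⟩] at this
  have hd0 (p : ℤ × ℤ) : 0 ≤ d p := by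
    simp only [hd]
    split_ifs
    exacts [pairEnergy_nonneg hV0 _ _, le_rfl]
  have hpt (p : ℤ × ℤ) : pairEnergy V (patch N Z X) p - pairEnergy V X p ≤ r p + l p - d p ∧
      |pairEnergy V (patch N Z X) p - pairEnergy V X p| ≤ r p + l p + d p := by
    by_cases hpW : p ∈ W
    · have hp := hpW
      rw [hW, Finset.mem_product, Finset.mem_Ico, Finset.mem_Ico] at hp
      have e1 : pairEnergy V (patch N Z X) p = 0 := by
        rw [pairEnergy_congr (patch_of_mem hp.1) (patch_of_mem hp.2), hZ]
      have e2 : d p = pairEnergy V X p := if_pos hpW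
      rw [e1, e2, zero_sub, abs_neg, abs_of_nonneg (pairEnergy_nonneg hV0 _ _)]
      constructor <;> linarith [hr0 p, hl0 p]
    · have e2 : d p = 0 := if_neg hpW
      rw [e2, sub_zero, add_zero]
      suffices |pairEnergy V (patch N Z X) p - pairEnergy V X p| ≤ r p + l p from
        ⟨(le_abs_self _).trans this, this⟩
      rw [hW, Finset.mem_product, Finset.mem_Ico, Finset.mem_Ico] at hpW
      by_cases hout : ¬ (0 ≤ p.1 ∧ p.1 < N) ∧ ¬ (0 ≤ p.2 ∧ p.2 < N)
      · rw [pairEnergy_congr (patch_of_notMem hout.1) (patch_of_notMem hout.2), sub_self,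
          abs_zero]
        exact add_nonneg (hr0 p) (hl0 p)
      · have hB : |pairEnergy V (patch N Z X) p - pairEnergy V X p| ≤
            if p.1 < p.2 then V (p.2 - p.1).toNat else 0 :=
          abs_sub_le_of_nonneg_of_le (pairEnergy_nonneg hV0 _ _) (pairEnergy_le hV0 _)
            (pairEnergy_nonneg hV0 _ _) (pairEnergy_le hV0 _)
        refine hB.trans ?_
        split_ifs with hlt
        · by_cases h1 : 0 ≤ p.1 ∧ p.1 < N
          · exact (hr1 h1 (by omega)).trans (le_add_of_nonneg_right (hl0 p))
          · exact (hl1 (by omega) (by omega)).trans (le_add_of_nonneg_left (hr0 p))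
        · exact add_nonneg (hr0 p) (hl0 p)
  have hsum : Summable fun p => pairEnergy V (patch N Z X) p - pairEnergy V X p :=
    Summable.of_norm_bounded ((hrs.add hls).add hds).summable fun p => (hpt p).2
  have hle := hasSum_le (fun p => (hpt p).1) hsum.hasSum ((hrs.add hls).sub hds)
  have hrefl : ∑ i ∈ Finset.range N, couplingTail V (N - i) =
      ∑ i ∈ Finset.range N, couplingTail V (i + 1) := by
    rw [← Finset.sum_range_reflect]
    refine Finset.sum_congr rfl fun i hi => ?_
    have := Finset.mem_range.1 hi
    congr 1
    omega
  rw [hrefl] at hle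
  linarith

/-- Patching a window with a configuration free of zero blocks removes the zero blocks inside the
window, up to boundary terms. -/
lemma finsum_zeroBlockInd_patch_le {m : ℕ} {Z : ℤ → Fin 2} (hZ : ∀ i, zeroBlockInd m Z i = 0)
    (X : ℤ → Fin 2) (N : ℕ) :
    ∑ᶠ i : ℤ, (zeroBlockInd m (patch N Z X) i - zeroBlockInd m X i) ≤
      2 * m - ∑ i ∈ Finset.Ico (0 : ℤ) N, zeroBlockInd m X i := by
  have hsupp : (Function.support fun i : ℤ =>
      zeroBlockInd m (patch N Z X) i - zeroBlockInd m X i) ⊆ Finset.Ico (-m : ℤ) N := by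
    intro i hi
    by_contra h
    rw [Finset.coe_Ico, Set.mem_Ico] at h
    apply hi
    have (j : ℕ) (hj : j < m) : patch N Z X (i + j) = X (i + j) := patch_of_notMem (by omega)
    simp +contextual only [zeroBlockInd, this, sub_self]
  rw [finsum_eq_sum_of_support_subset _ hsupp, Finset.sum_sub_distrib]
  have h1 : ∑ i ∈ Finset.Ico (-m : ℤ) N, zeroBlockInd m (patch N Z X) i ≤ 2 * m := by
    have hpt : ∀ i ∈ Finset.Ico (-m : ℤ) N, zeroBlockInd m (patch N Z X) i ≤
        if i ∈ Finset.Ico (-m : ℤ) 0 ∪ Finset.Ico (N - m : ℤ) N then 1 else 0 := by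
      intro i hi
      rw [Finset.mem_Ico] at hi
      split_ifs with h
      · exact zeroBlockInd_le_one _ _ _
      · simp only [Finset.mem_union, Finset.mem_Ico] at h
        rw [← hZ i]
        refine le_of_eq ?_
        have (j : ℕ) (hj : j < m) : patch N Z X (i + j) = Z (i + j) := patch_of_mem (by omega)
        simp +contextual only [zeroBlockInd, this]
    refine (Finset.sum_le_sum hpt).trans ?_
    rw [← Finset.sum_filter, Finset.sum_const, nsmul_one]
    have hc : ((Finset.Ico (-m : ℤ) N).filter fun i =>
        i ∈ Finset.Ico (-m : ℤ) 0 ∪ Finset.Ico (N - m : ℤ) N).card ≤ 2 * m := by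
      refine (Finset.card_le_card (t := Finset.Ico (-m : ℤ) 0 ∪ Finset.Ico (N - m : ℤ) N)
        fun i hi => (Finset.mem_filter.1 hi).2).trans ((Finset.card_union_le _ _).trans ?_)
      rw [Int.card_Ico, Int.card_Ico]
      omega
    exact_mod_cast hc
  have h2 : ∑ i ∈ Finset.Ico (0 : ℤ) N, zeroBlockInd m X i ≤
      ∑ i ∈ Finset.Ico (-m : ℤ) N, zeroBlockInd m X i :=
    Finset.sum_le_sum_of_subset_of_nonneg (Finset.Ico_subset_Ico_left (by omega))
      fun i _ _ => zeroBlockInd_nonneg _ _ _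
  linarith

/-- A ground state has at most boundary-order energy in each window if some configuration has
zero energy. -/
lemma IsGS.window_energy_le {V : ℕ → ℝ} (hV0 : ∀ k, 0 ≤ V k) (hV : Summable V) {m : ℕ}
    {Z : ℤ → Fin 2} (hZp : ∀ p, pairEnergy V Z p = 0) (hZm : ∀ i, zeroBlockInd m Z i = 0)
    {X : ℤ → Fin 2} (hX : IsGS V m X) (N : ℕ) :
    ∑ p ∈ Finset.Ico (0 : ℤ) N ×ˢ Finset.Ico (0 : ℤ) N, pairEnergy V X p +
      ∑ i ∈ Finset.Ico (0 : ℤ) N, zeroBlockInd m X i ≤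
      2 * ∑ i ∈ Finset.range N, couplingTail V (i + 1) + 2 * m := by
  have h := hX _ (localExc_patch N Z X)
  have hterm : (fun p : ℤ × ℤ => if p.1 < p.2 then
      V (p.2 - p.1).toNat * (pairInd (patch N Z X) p - pairInd X p) else 0) =
      fun p => pairEnergy V (patch N Z X) p - pairEnergy V X p := by
    funext p
    unfold pairEnergy
    split_ifs <;> ring
  rw [HRel, hterm] at h
  have h1 := tsum_pairEnergy_patch_le hV0 hV hZp X N
  have h2 := finsum_zeroBlockInd_patch_le hZm X N
  linarith

lemma exists_couplingTail_sum_le {V : ℕ → ℝ} (m : ℕ) {ε : ℝ} (hε : 0 < ε) :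
    ∃ N₀ : ℕ, ∀ N ≥ N₀, 2 * ∑ i ∈ Finset.range N, couplingTail V (i + 1) + 2 * m ≤ ε * N := by
  have h1 : Filter.Tendsto (fun i => couplingTail V (i + 1)) Filter.atTop (nhds 0) :=
    (Filter.tendsto_add_atTop_iff_nat 1).2 (tendsto_sum_nat_add V)
  have h2 := h1.cesaro
  have h3 := tendsto_const_div_atTop_nhds_zero_nat (m : ℝ)
  have h4 := (h2.add h3).const_mul 2
  rw [add_zero, mul_zero] at h4
  obtain ⟨N₀, hN₀⟩ := Filter.eventually_atTop.1 (h4.eventually_le_const hε)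
  refine ⟨N₀ + 1, fun N hN => ?_⟩
  have hN0 : (0 : ℝ) < N := by exact_mod_cast (by omega : 0 < N)
  have := hN₀ N (by omega)
  have h5 : 2 * ((N : ℝ)⁻¹ * ∑ i ∈ Finset.range N, couplingTail V (i + 1) + m / N) * N =
      2 * ∑ i ∈ Finset.range N, couplingTail V (i + 1) + 2 * m := by
    field_simp
  rw [← h5]
  exact mul_le_mul_of_nonneg_right this hN0.le

end WindowEnergy

section GroundStateMeasures

/-- An event whose visits in windows of ground states have vanishing density is null. -/
lemma measure_eq_zero_of_visitCount_le {V : ℕ → ℝ} {m : ℕ} {μ : Measure (ℤ → Fin 2)}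
    [IsProbabilityMeasure μ] (hμ : ShiftInv μ) (hGS : μ {X | IsGS V m X} = 1)
    {A : Set (ℤ → Fin 2)} (hA : MeasurableSet A) {c : ℝ} (hc : 0 < c) (k : ℕ)
    (h : ∀ X, IsGS V m X → ∀ N : ℕ, c * visitCount A N X ≤
      2 * ∑ i ∈ Finset.range (N + k), couplingTail V (i + 1) + 2 * m) : μ A = 0 := by
  suffices μ.real A = 0 by
    rwa [measureReal_def, ENNReal.toReal_eq_zero_iff, or_iff_left (measure_ne_top _ _)] at this
  refine le_antisymm (le_of_forall_pos_le_add fun ε hε => ?_) measureReal_nonneg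
  obtain ⟨N₀, hN₀⟩ := exists_couplingTail_sum_le (V := V) m (ε := ε * c / 2) (by positivity)
  set N := N₀ + k + 1 with hN
  have hb := hN₀ (N + k) (by omega)
  have hmem : ∀ X ∈ {X | IsGS V m X}, visitCount A N X ∈ Set.Icc 0 (ε * N) := by
    intro X hX
    refine ⟨Finset.sum_nonneg fun i _ => Set.indicator_nonneg (fun _ _ => zero_le_one) _, ?_⟩
    have h1 := (h X hX N).trans hb
    have h2 : ((N + k : ℕ) : ℝ) ≤ 2 * N := by exact_mod_cast (by omega : N + k ≤ 2 * N)
    have h3 : ε * c / 2 * ((N + k : ℕ) : ℝ) ≤ ε * c / 2 * (2 * N) := by gcongr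
    refine le_of_mul_le_mul_left ?_ hc
    linarith
  have h4 := (measureReal_mem_Icc_of_visitCount hμ hA hGS hmem).2
  have hN0 : (0 : ℝ) < N := by exact_mod_cast (by omega : 0 < N)
  refine le_of_mul_le_mul_left ?_ hN0
  linarith

lemma sum_Ico_intCast (f : ℤ → ℝ) (N : ℕ) :
    ∑ i ∈ Finset.Ico (0 : ℤ) N, f i = ∑ i ∈ Finset.range N, f i := by
  refine (Finset.sum_bij (fun (n : ℕ) _ => (n : ℤ)) ?_ ?_ ?_ ?_).symm
  · intro n hn
    simpa using hn
  · intro a _ b _ h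
    exact_mod_cast h
  · intro b hb
    rw [Finset.mem_Ico] at hb
    exact ⟨b.toNat, Finset.mem_range.2 (by omega), by omega⟩
  · intro n _
    rfl

lemma measurableSet_eval_eq (i : ℤ) (a : Fin 2) : MeasurableSet {X : ℤ → Fin 2 | X i = a} :=
  measurableSet_eq_fun (measurable_pi_apply i) measurable_const

lemma measurableSet_zeroBlock (m : ℕ) :
    MeasurableSet {X : ℤ → Fin 2 | ∀ j : ℕ, j < m → X j = 0} := by
  simp only [Set.ofPred_forall]
  exact .iInter fun j => .iInter fun _ => measurableSet_eval_eq _ _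

/-- Shift-invariant measures on ground states see no zero blocks. -/
lemma measure_zeroBlock_eq_zero {V : ℕ → ℝ} (hV0 : ∀ k, 0 ≤ V k) (hV : Summable V) {m : ℕ}
    {Z : ℤ → Fin 2} (hZp : ∀ p, pairEnergy V Z p = 0) (hZm : ∀ i, zeroBlockInd m Z i = 0)
    {μ : Measure (ℤ → Fin 2)} [IsProbabilityMeasure μ] (hμ : ShiftInv μ)
    (hGS : μ {X | IsGS V m X} = 1) :
    μ {X | ∀ j : ℕ, j < m → X j = 0} = 0 := by
  refine measure_eq_zero_of_visitCount_le hμ hGS (measurableSet_zeroBlock m) one_pos 0 fun X hX N => ?_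
  have h := hX.window_energy_le hV0 hV hZp hZm N
  have h0 : 0 ≤ ∑ p ∈ Finset.Ico (0 : ℤ) N ×ˢ Finset.Ico (0 : ℤ) N, pairEnergy V X p :=
    Finset.sum_nonneg fun p _ => pairEnergy_nonneg hV0 _ _
  have h1 : visitCount {X : ℤ → Fin 2 | ∀ j : ℕ, j < m → X j = 0} N X =
      ∑ i ∈ Finset.Ico (0 : ℤ) N, zeroBlockInd m X i := by
    classical
    rw [sum_Ico_intCast]
    refine Finset.sum_congr rfl fun i _ => ?_
    rw [siteShift_iterate, Set.indicator_apply, zeroBlockInd]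
    simp only [Set.mem_ofPred_eq, add_comm]
  rw [add_zero, one_mul, h1]
  linarith

/-- Shift-invariant measures on ground states see no interacting pairs. -/
lemma measure_pair_eq_zero {V : ℕ → ℝ} (hV0 : ∀ k, 0 ≤ V k) (hV : Summable V) {m : ℕ}
    {Z : ℤ → Fin 2} (hZp : ∀ p, pairEnergy V Z p = 0) (hZm : ∀ i, zeroBlockInd m Z i = 0)
    {μ : Measure (ℤ → Fin 2)} [IsProbabilityMeasure μ] (hμ : ShiftInv μ)
    (hGS : μ {X | IsGS V m X} = 1) {k : ℕ} (hk : 0 < k) (hVk : 0 < V k) :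
    μ {X | X 0 = 1 ∧ X k = 1} = 0 := by
  have hA : MeasurableSet {X : ℤ → Fin 2 | X 0 = 1 ∧ X k = 1} :=
    (measurableSet_eval_eq _ _).inter (measurableSet_eval_eq _ _)
  refine measure_eq_zero_of_visitCount_le hμ hGS hA hVk k fun X hX N => ?_
  have h := hX.window_energy_le hV0 hV hZp hZm (N + k)
  have h0 : 0 ≤ ∑ i ∈ Finset.Ico (0 : ℤ) (N + k : ℕ), zeroBlockInd m X i :=
    Finset.sum_nonneg fun p _ => zeroBlockInd_nonneg _ _ _
  set P : Finset (ℤ × ℤ) := (Finset.range N).image fun n : ℕ => ((n : ℤ), (n : ℤ) + k) with hP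
  have h1 : V k * visitCount {X : ℤ → Fin 2 | X 0 = 1 ∧ X k = 1} N X =
      ∑ p ∈ P, pairEnergy V X p := by
    classical
    rw [hP, Finset.sum_image fun a _ b _ hab => by simpa using hab, visitCount, Finset.mul_sum]
    refine Finset.sum_congr rfl fun i _ => ?_
    have hlt : (i : ℤ) < i + k := by omega
    rw [siteShift_iterate, Set.indicator_apply, pairEnergy]
    simp only [hlt, if_true, Set.mem_ofPred_eq, pairInd, zero_add, add_sub_cancel_left,
      Int.toNat_natCast, add_comm (k : ℤ)]
  have h2 : ∑ p ∈ P, pairEnergy V X p ≤ ∑ p ∈ Finset.Ico (0 : ℤ) (N + k : ℕ) ×ˢ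
      Finset.Ico (0 : ℤ) (N + k : ℕ), pairEnergy V X p := by
    refine Finset.sum_le_sum_of_subset_of_nonneg ?_ fun p _ _ => pairEnergy_nonneg hV0 _ _
    intro p hp
    obtain ⟨n, hn, rfl⟩ := Finset.mem_image.1 hp
    rw [Finset.mem_range] at hn
    simp only [Finset.mem_product, Finset.mem_Ico]
    omega
  rw [h1]
  linarith

lemma ShiftInv.measure_translate_eq_zero {μ : Measure (ℤ → Fin 2)} (hμ : ShiftInv μ)
    {A : Set (ℤ → Fin 2)} (hA : MeasurableSet A) (h : μ A = 0) (n : ℤ) :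
    μ {X | (fun i => X (i + n)) ∈ A} = 0 := by
  have hmp := hμ.measurePreserving_siteShift
  have hB : MeasurableSet {X : ℤ → Fin 2 | (fun i => X (i + n)) ∈ A} :=
    measurable_pi_lambda (fun (X : ℤ → Fin 2) i => X (i + n))
      (fun i => measurable_pi_apply (i + n)) hA
  rcases le_total 0 n with hn | hn
  · rw [← h, ← (hmp.iterate n.toNat).measure_preimage hA.nullMeasurableSet]
    congr 1
    ext X
    rw [Set.mem_preimage, siteShift_iterate, Int.toNat_of_nonneg hn, Set.mem_ofPred_eq]
  · rw [← h, ← (hmp.iterate (-n).toNat).measure_preimage hB.nullMeasurableSet]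
    congr 1
    ext X
    rw [Set.mem_preimage, siteShift_iterate, Int.toNat_of_nonneg (by omega), Set.mem_ofPred_eq]
    simp

end GroundStateMeasures

/-- Given the forbidden-pattern characterization of `G_St(φ)` by `m` and `F`,
for every summable strictly positive `g : ℕ → (0,∞)` there is `V : ℕ → [0,∞)` with
`V(k) > 0 ↔ k ∈ F` and `V ≤ g`, such that every shift-invariant probability measure supported
on the ground-state configurations of the associated non-frustrated Hamiltonian is the unique
shift-invariant probability measure supported on `G_St(φ)`. -/
theorem sturmian_ground_states_of_twobody_interactions
    (φ : ℝ) (hφ : Irrational φ) (hφ1 : 1/2 < φ) (hφ2 : φ < 1)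
    (m : ℕ) (F : Set ℕ)
    (hchar : ∀ X : ℤ → Fin 2,
      X ∈ GSt φ ↔
        ((¬ ∃ n : ℤ, ∀ i : ℕ, i < m → X (n + i) = 0) ∧
         (¬ ∃ n : ℤ, ∃ k ∈ F, X n = 1 ∧ X (n + k) = 1)))
    (g : ℕ → ℝ) (hg : Summable g) (hgpos : ∀ k, 0 < g k) :
    ∃ V : ℕ → ℝ, (∀ k, 0 ≤ V k) ∧ (∀ k, 0 < V k ↔ k ∈ F) ∧ (∀ k, V k ≤ g k) ∧
      ∀ μ : Measure (ℤ → Fin 2), IsProbabilityMeasure μ → ShiftInv μ →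
        μ {X | IsGS V m X} = 1 →
          (μ (GSt φ) = 1 ∧
            ∀ ν : Measure (ℤ → Fin 2), IsProbabilityMeasure ν → ShiftInv ν →
              ν (GSt φ) = 1 → ν = μ) := by
  classical
  have hZ := (hchar _).1 (sturmian_mem_GSt φ)
  have hF0 : 0 ∉ F := by
    intro h0
    refine hZ.1 ⟨0, fun i _ => ?_⟩
    have h1 : sturmian φ (0 + i) ≠ 1 := fun h => hZ.2 ⟨0 + i, 0, h0, h, by simpa using h⟩
    omega
  set V : ℕ → ℝ := fun k => if k ∈ F then g k else 0 with hVdef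
  have hV0 (k : ℕ) : 0 ≤ V k := by
    simp only [hVdef]
    split_ifs
    exacts [(hgpos k).le, le_rfl]
  have hVg (k : ℕ) : V k ≤ g k := by
    simp only [hVdef]
    split_ifs
    exacts [le_rfl, (hgpos k).le]
  have hVF (k : ℕ) : 0 < V k ↔ k ∈ F := by
    by_cases h : k ∈ F <;> simp [hVdef, h, hgpos k]
  have hV : Summable V := hg.of_nonneg_of_le hV0 hVg
  have hZp (p : ℤ × ℤ) : pairEnergy V (sturmian φ) p = 0 := by
    unfold pairEnergy
    split_ifs with hlt
    · by_cases hF : (p.2 - p.1).toNat ∈ F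
      · refine mul_eq_zero_of_right _ (if_neg fun h => hZ.2 ⟨p.1, _, hF, h.1, ?_⟩)
        rw [Int.toNat_of_nonneg (by omega), add_sub_cancel]
        exact h.2
      · rw [show V (p.2 - p.1).toNat = 0 from if_neg hF, zero_mul]
    · rfl
  have hZm (i : ℤ) : zeroBlockInd m (sturmian φ) i = 0 := if_neg fun h => hZ.1 ⟨i, h⟩
  refine ⟨V, hV0, hVF, hVg, fun μ hprob hμ hGS => ?_⟩
  have hμG : μ (GSt φ) = 1 := by
    have hG : MeasurableSet (GSt φ) := isClosed_closure.measurableSet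
    rw [← prob_compl_eq_zero_iff hG]
    have hzero (n : ℤ) := hμ.measure_translate_eq_zero (measurableSet_zeroBlock m)
      (measure_zeroBlock_eq_zero hV0 hV hZp hZm hμ hGS) n
    have hpair (n : ℤ) (k : F) := hμ.measure_translate_eq_zero
      ((measurableSet_eval_eq 0 1).inter (measurableSet_eval_eq (k : ℕ) 1))
      (measure_pair_eq_zero hV0 hV hZp hZm hμ hGS
        (Nat.pos_of_ne_zero fun h => hF0 (h ▸ k.2)) ((hVF k).2 k.2)) n
    refine measure_mono_null ?_ (measure_union_null (measure_iUnion_null hzero)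
      (measure_iUnion_null fun n => measure_iUnion_null (hpair n)))
    intro X hX
    rw [Set.mem_compl_iff, hchar, not_and_or, not_not, not_not] at hX
    rcases hX with ⟨n, h⟩ | ⟨n, k, hk, h0, h1⟩
    · refine Or.inl (Set.mem_iUnion.2 ⟨n, fun j hj => ?_⟩)
      change X (j + n) = 0
      rw [add_comm]
      exact h j hj
    · refine Or.inr (Set.mem_iUnion.2 ⟨n, Set.mem_iUnion.2 ⟨⟨k, hk⟩, ?_, ?_⟩⟩)
      · simpa using h0
      · simpa [add_comm] using h1
  exact ⟨hμG, fun ν _ hν hνG => eq_of_measure_GSt_eq_one hφ hμ hν hμG hνG⟩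
end

section
/- Let Z = {X ∈ {+1,−1}^ℤ : (X(i)+X(i+2^r))·(X(i+(2p+1)2^r)+X(i+(2p+2)2^r)) = 0 for all i ∈ ℤ and all r, p ≥ 0} be the set of zero-energy configurations of the Thue–Morse interactions. Then every shift-invariant Borel probability measure μ on {+1,−1}^ℤ with μ(Z) = 1 satisfies μ(G_TM) = 1, i.e. the Thue–Morse measure is the only translation-invariant ground state of the Thue–Morse Hamiltonian. -/
open MeasureTheory

/-- `t(n) = (−1)^{s(n)}` where `s(n)` is the sum of binary digits of `n` (Thue–Morse). -/
def tmSign (n : ℕ) : ℤ := (-1) ^ ((Nat.digits 2 n).sum)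

/-- The two-sided Thue–Morse configuration in `{+1,−1}^ℤ`. -/
def XTM : ℤ → ℤ := fun n => if 0 ≤ n then tmSign n.toNat else tmSign (-n - 1).toNat

/-- `G_TM`: the closure in the product topology of the shift orbit of `X_TM`. -/
def GTM : Set (ℤ → ℤ) := closure {Y | ∃ k : ℤ, Y = fun n => XTM (n - k)}

/-- The set `Z` of zero-energy configurations of the Thue–Morse interactions inside
`{+1,−1}^ℤ`: spin configurations with
`(X(i)+X(i+2^r))·(X(i+(2p+1)2^r)+X(i+(2p+2)2^r)) = 0` for all `i ∈ ℤ`, `r, p ≥ 0`. -/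
def tmZeroEnergy : Set (ℤ → ℤ) :=
  {X | (∀ i : ℤ, X i = 1 ∨ X i = -1) ∧
    ∀ i : ℤ, ∀ r p : ℕ,
      (X i + X (i + 2 ^ r)) *
        (X (i + (2 * (p : ℤ) + 1) * 2 ^ r) + X (i + (2 * (p : ℤ) + 2) * 2 ^ r)) = 0}

theorem tmSign_two_mul (n : ℕ) : tmSign (2 * n) = tmSign n := by
  rcases Nat.eq_zero_or_pos n with rfl | hn
  · rfl
  · simp [tmSign, Nat.digits_base_mul one_lt_two hn]

theorem tmSign_two_mul_add_one (n : ℕ) : tmSign (2 * n + 1) = -tmSign n := by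
  have h := Nat.digits_add_two_add_one 0 (2 * n)
  rw [show (2 * n + 1) % (0 + 2) = 1 by omega, show (2 * n + 1) / (0 + 2) = n by omega] at h
  simp only [zero_add] at h
  rw [tmSign, h, List.sum_cons, pow_add, pow_one, neg_one_mul, tmSign]

/-- One of the two partitions of `ℤ` into pairs of neighbours has only pairs of opposite spins. -/
theorem exists_pairing_of_mem_tmZeroEnergy {X : ℤ → ℤ} (hX : X ∈ tmZeroEnergy) :
    ∃ c : ℤ, ∀ m : ℤ, X (2 * m + c + 1) = -X (2 * m + c) := by
  by_contra! h
  obtain ⟨a, ha⟩ := h 0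
  obtain ⟨b, hb⟩ := h 1
  have ha' : X (2 * a) + X (2 * a + 1) ≠ 0 := fun h0 => ha (by simp only [add_zero]; linarith)
  have hb' : X (2 * b + 1) + X (2 * b + 1 + 1) ≠ 0 := fun h0 => hb (by linarith)
  rcases le_or_gt a b with hab | hab
  · have key := hX.2 (2 * a) 0 (b - a).toNat
    rw [Int.toNat_of_nonneg (by omega), pow_zero,
      show 2 * a + (2 * (b - a) + 1) * 1 = 2 * b + 1 by ring,
      show 2 * a + (2 * (b - a) + 2) * 1 = 2 * b + 1 + 1 by ring] at key
    exact mul_ne_zero ha' hb' key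
  · have key := hX.2 (2 * b + 1) 0 (a - b - 1).toNat
    rw [Int.toNat_of_nonneg (by omega), pow_zero,
      show 2 * b + 1 + (2 * (a - b - 1) + 1) * 1 = 2 * a by ring,
      show 2 * b + 1 + (2 * (a - b - 1) + 2) * 1 = 2 * a + 1 by ring] at key
    exact mul_ne_zero hb' ha' key

/-- Decimating a zero-energy configuration by two gives a zero-energy configuration. -/
theorem decimate_mem_tmZeroEnergy {X : ℤ → ℤ} (hX : X ∈ tmZeroEnergy) (c : ℤ) :
    (fun m => X (2 * m + c)) ∈ tmZeroEnergy := by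
  refine ⟨fun i => hX.1 _, fun i r p => ?_⟩
  have h := hX.2 (2 * i + c) (r + 1) p
  convert h using 4 <;> ring

/-- Every finite window of a zero-energy configuration occurs in the Thue–Morse sequence. -/
theorem exists_tmSign_window (n : ℕ) : ∀ X ∈ tmZeroEnergy, ∀ i : ℤ,
    ∃ j : ℕ, ∀ d ≤ n, X (i + d) = tmSign (j + d) := by
  induction n using Nat.strong_induction_on with
  | _ n ih =>
    intro X hX i
    rcases lt_or_ge n 2 with hn | hn
    · have t0 : tmSign 0 = 1 := rfl
      have t1 : tmSign 1 = -1 := by simpa [t0] using tmSign_two_mul_add_one 0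
      have t2 : tmSign 2 = -1 := by simpa [t1] using tmSign_two_mul 1
      have t3 : tmSign 3 = 1 := by simpa [t1] using tmSign_two_mul_add_one 1
      have t5 : tmSign 5 = 1 := by simpa [t2] using tmSign_two_mul_add_one 2
      have t6 : tmSign 6 = 1 := by simpa [t3] using tmSign_two_mul 3
      have of_two : ∀ j : ℕ, X i = tmSign j → X (i + 1) = tmSign (j + 1) →
          ∃ j : ℕ, ∀ d ≤ n, X (i + d) = tmSign (j + d) := by
        intro j h0 h1
        refine ⟨j, fun d hd => ?_⟩
        obtain rfl | rfl : d = 0 ∨ d = 1 := by omega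
        · simpa using h0
        · simpa using h1
      rcases hX.1 i with h0 | h0 <;> rcases hX.1 (i + 1) with h1 | h1
      · exact of_two 5 (h0.trans t5.symm) (h1.trans t6.symm)
      · exact of_two 0 (h0.trans t0.symm) (h1.trans t1.symm)
      · exact of_two 2 (h0.trans t2.symm) (h1.trans t3.symm)
      · exact of_two 1 (h0.trans t1.symm) (h1.trans t2.symm)
    · obtain ⟨c, hc⟩ := exists_pairing_of_mem_tmZeroEnergy hX
      obtain ⟨j, hj⟩ := ih ((n + 1) / 2) (by omega) _ (decimate_mem_tmZeroEnergy hX c) ((i - c) / 2)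
      obtain ⟨e, he, hi⟩ : ∃ e : ℕ, e < 2 ∧ i = 2 * ((i - c) / 2) + c + e :=
        ⟨((i - c) % 2).toNat, by omega, by omega⟩
      refine ⟨2 * j + e, fun d hd => ?_⟩
      have hq := hj ((e + d) / 2) (by omega)
      rcases Nat.mod_two_eq_zero_or_one (e + d) with hm | hm
      · rw [show 2 * j + e + d = 2 * (j + (e + d) / 2) by omega, tmSign_two_mul, ← hq]
        congr 1
        omega
      · rw [show 2 * j + e + d = 2 * (j + (e + d) / 2) + 1 by omega, tmSign_two_mul_add_one, ← hq,
          ← hc]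
        congr 1
        omega

theorem tmZeroEnergy_subset_GTM : tmZeroEnergy ⊆ GTM := by
  intro X hX
  choose j hj using fun n : ℕ => exists_tmSign_window (2 * n) X hX (-n)
  refine mem_closure_of_tendsto (f := fun (n : ℕ) (k : ℤ) => XTM (k - (-n - j n)))
    (b := Filter.atTop) ?_ (Filter.Eventually.of_forall fun n => ⟨_, rfl⟩)
  refine tendsto_pi_nhds.2 fun k => tendsto_const_nhds.congr' ?_
  filter_upwards [Filter.eventually_ge_atTop k.natAbs] with n hn
  have h := hj n (k + n).toNat (by omega)
  rw [Int.toNat_of_nonneg (by omega), show -(n : ℤ) + (k + n) = k by ring] at h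
  rw [h, XTM, if_pos (by omega)]
  congr 1
  omega

/-- Every shift-invariant Borel probability measure supported on the
zero-energy configurations of the Thue–Morse interactions is supported on `G_TM`; i.e. the
Thue–Morse measure is the only translation-invariant ground state of the Thue–Morse
Hamiltonian. -/
theorem thueMorse_unique_ground_state
    (μ : Measure (ℤ → ℤ)) (hprob : IsProbabilityMeasure μ)
    (hinv : Measure.map (fun X (n : ℤ) => X (n - 1)) μ = μ)
    (hsupp : μ tmZeroEnergy = 1) :
    μ GTM = 1 := by
  exact le_antisymm prob_le_one (hsupp ▸ measure_mono tmZeroEnergy_subset_GTM)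
end

section
/- For every irrational φ ∈ (0,1), the Sturmian system is uniquely ergodic: there exists exactly one shift-invariant Borel probability measure μ on {0,1}^ℤ with μ(G_St(φ)) = 1. -/
open MeasureTheory

/-- Composition with the rotation by `a`, as an operator on continuous functions. -/
noncomputable def rotationOperator (a : UnitAddCircle) (g : C(UnitAddCircle, ℂ)) :
    C(UnitAddCircle, ℂ) :=
  g.comp (ContinuousMap.addRight a)

theorem birkhoffAverage_rotationOperator_apply (a : UnitAddCircle) (g : C(UnitAddCircle, ℂ))
    (N : ℕ) (x : UnitAddCircle) :
    birkhoffAverage ℂ (rotationOperator a) id N g x =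
      (N : ℂ)⁻¹ * ∑ k ∈ Finset.range N, g (x + k • a) := by
  have key : ∀ k : ℕ, ∀ y, (rotationOperator a)^[k] g y = g (y + k • a) := by
    intro k
    induction k with
    | zero => simp
    | succ k ih =>
      intro y
      rw [Function.iterate_succ_apply']
      change (rotationOperator a)^[k] g (y + a) = _
      rw [ih, succ_nsmul', add_assoc]
  simp [birkhoffAverage, birkhoffSum, key]

open Filter Topology in
/-- Weyl equidistribution for irrational rotations, uniformly in the starting point. -/
theorem tendsto_birkhoffAverage_rotationOperator {a : UnitAddCircle} (ha : addOrderOf a = 0)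
    (g : C(UnitAddCircle, ℂ)) :
    Tendsto (birkhoffAverage ℂ (rotationOperator a) id · g) atTop
      (𝓝 (ContinuousMap.const _ (∫ x, g x))) := by
  have hint : ∀ h : C(UnitAddCircle, ℂ), Integrable h volume := fun h =>
    h.continuous.integrable_of_hasCompactSupport (HasCompactSupport.of_compactSpace _)
  have hlip : LipschitzWith 1 (rotationOperator a) := by
    refine LipschitzWith.of_dist_le_mul fun f h => ?_
    rw [NNReal.coe_one, one_mul, ContinuousMap.dist_le dist_nonneg]
    exact fun x => ContinuousMap.dist_apply_le_dist (f := f) (g := h) (x + a)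
  have hcont : Continuous fun h : C(UnitAddCircle, ℂ) =>
      ContinuousMap.const UnitAddCircle (∫ x, h x) := by
    refine ContinuousMap.continuous_const'.comp ?_
    refine continuous_iff_continuousAt.2 fun h => ?_
    refine tendsto_integral_filter_of_dominated_convergence (fun _ => ‖h‖ + 1) ?_ ?_ ?_ ?_
    · exact Eventually.of_forall fun f => f.continuous.aestronglyMeasurable
    · filter_upwards [Metric.ball_mem_nhds h one_pos] with f hf
      refine Eventually.of_forall fun x => (f.norm_coe_le_norm x).trans ?_
      rw [Metric.mem_ball, dist_eq_norm] at hf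
      have := norm_sub_norm_le f h
      linarith
    · exact integrable_const _
    · exact Eventually.of_forall fun x => (continuous_eval_const x).tendsto h
  have hclosed := isClosed_setOfPred_tendsto_birkhoffAverage ℂ hlip uniformContinuous_id hcont
  have hsub : (Submodule.span ℂ (Set.range (@fourier 1)) : Set C(UnitAddCircle, ℂ)) ⊆
      {h | Tendsto (birkhoffAverage ℂ (rotationOperator a) id · h) atTop
        (𝓝 (ContinuousMap.const _ (∫ x, h x)))} := by
    intro h hh
    induction hh using Submodule.span_induction with
    | zero =>
      have : ∀ N, birkhoffAverage ℂ (rotationOperator a) id N 0 = 0 := fun N => by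
        ext x; simp [birkhoffAverage_rotationOperator_apply]
      simp only [Set.mem_ofPred_eq, this]
      convert! tendsto_const_nhds
      simp
    | add f h _ _ hf hh =>
      have key : ∀ N, birkhoffAverage ℂ (rotationOperator a) id N (f + h) =
          birkhoffAverage ℂ (rotationOperator a) id N f +
            birkhoffAverage ℂ (rotationOperator a) id N h := fun N => by
        ext x
        simp [birkhoffAverage_rotationOperator_apply, Finset.sum_add_distrib, mul_add]
      simp only [Set.mem_ofPred_eq, key]
      convert! Tendsto.add hf hh using 2
      ext x
      simp [integral_add (hint f) (hint h)]
    | smul c f _ hf =>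
      have key : ∀ N, birkhoffAverage ℂ (rotationOperator a) id N (c • f) =
          c • birkhoffAverage ℂ (rotationOperator a) id N f := fun N => by
        ext x
        simp [birkhoffAverage_rotationOperator_apply, ← Finset.mul_sum, mul_left_comm]
      simp only [Set.mem_ofPred_eq, key]
      convert! Tendsto.const_smul hf c using 2
      ext x
      simp [integral_const_mul]
    | mem f hf =>
      obtain ⟨n, rfl⟩ := hf
      rcases eq_or_ne n 0 with rfl | hn
      · refine tendsto_const_nhds.congr' ?_
        filter_upwards [eventually_ne_atTop 0] with N hN
        ext x
        simp [birkhoffAverage_rotationOperator_apply, hN, measureReal_def]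
      set e : C(UnitAddCircle, ℂ) := fourier n
      set c : ℂ := e a
      have hc : c ≠ 1 := by
        intro h
        have h1 : AddCircle.toCircle (n • a) = 1 := by
          apply Subtype.ext
          simpa [c, e, fourier_apply] using h
        rw [← AddCircle.toCircle_zero] at h1
        have h2 := AddCircle.injective_toCircle one_ne_zero h1
        rw [← addOrderOf_dvd_iff_zsmul_eq_zero, ha] at h2
        exact hn (by simpa using h2)
      have he : ∀ x, e (x + a) = c * e x := fun x => by
        simp only [e, c, fourier_apply, smul_add, AddCircle.toCircle_add, Circle.coe_mul, mul_comm]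
      have hRe : rotationOperator a e = c • e := by ext x; exact he x
      have key : ∀ N, birkhoffAverage ℂ (rotationOperator a) id N (c • e) =
          c • birkhoffAverage ℂ (rotationOperator a) id N e := fun N => by
        ext x
        simp [birkhoffAverage_rotationOperator_apply, ← Finset.mul_sum, mul_left_comm]
      have hzero : ∫ x, e x = 0 := by
        have h1 : ∫ x, e (x + a) = ∫ x, e x := integral_add_right_eq_self _ a
        simp only [he, integral_const_mul] at h1
        have : (c - 1) * ∫ x, e x = 0 := by rw [sub_mul, h1]; ring
        exact (mul_eq_zero.1 this).resolve_left (sub_ne_zero.2 hc)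
      have hbdd : Bornology.IsBounded (Set.range (id <| (rotationOperator a)^[·] e)) := by
        refine (Metric.isBounded_closedBall (x := (0 : C(UnitAddCircle, ℂ))) (r := ‖e‖)).subset ?_
        rintro _ ⟨k, rfl⟩
        have h0 : rotationOperator a 0 = 0 := rfl
        have := (hlip.iterate k).dist_le_mul e 0
        rw [Function.iterate_fixed h0] at this
        simpa using this
      have := tendsto_birkhoffAverage_apply_sub_birkhoffAverage ℂ hbdd
      simp only [hRe, key] at this
      have h2 := this.const_smul (c - 1)⁻¹
      simp only [Set.mem_ofPred_eq, hzero]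
      convert! h2 using 2 with N
      · rw [show ∀ f : C(UnitAddCircle, ℂ), c • f - f = (c - 1) • f from fun f => by
          ext x; simp [sub_mul], smul_smul, inv_mul_cancel₀ (sub_ne_zero.2 hc), one_smul]
      · ext x; simp
  have htop := closure_minimal hsub hclosed
  rw [← Submodule.topologicalClosure_coe, span_fourier_closure_eq_top] at htop
  exact htop (Set.mem_univ g)

/-- The symbolic coding of the orbit of `x` under rotation by `φ`. -/
noncomputable def coding (φ : ℝ) (x : UnitAddCircle) : ℤ → Fin 2 :=
  fun n => if (AddCircle.equivIco 1 0 (x + n • (φ : UnitAddCircle)) : ℝ) < φ then 0 else 1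

theorem coding_neg_zsmul (φ : ℝ) (k : ℤ) :
    coding φ (k • -(φ : UnitAddCircle)) = fun n => sturmian φ (n - k) := by
  funext n
  have h : k • -(φ : UnitAddCircle) + n • (φ : UnitAddCircle)
      = (((n - k : ℤ) * φ : ℝ) : UnitAddCircle) := by
    rw [← zsmul_eq_mul, AddCircle.coe_zsmul, sub_smul, smul_neg]
    abel
  simp only [coding, sturmian, h, AddCircle.coe_equivIco_mk_apply, div_one, mul_one]

theorem coding_sub_one (φ : ℝ) (x : UnitAddCircle) :
    (fun n => coding φ x (n - 1)) = coding φ (x + -(φ : UnitAddCircle)) := by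
  funext n
  simp only [coding]
  rw [show x + (n - 1) • (φ : UnitAddCircle) = x + -(φ : UnitAddCircle) + n • (φ : UnitAddCircle) by
    rw [sub_smul, one_smul]; abel]

theorem measurable_coding (φ : ℝ) : Measurable (coding φ) := by
  have h : Measurable fun x : UnitAddCircle => (AddCircle.equivIco 1 0 x : ℝ) :=
    measurable_of_continuousOn_compl_singleton 0 fun x hx =>
      (continuous_subtype_val.continuousAt.comp
        (AddCircle.continuousAt_equivIco 1 0 (x := x) (by simpa using hx))).continuousWithinAt
  refine measurable_pi_lambda _ fun n => Measurable.ite ?_ measurable_const measurable_const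
  exact measurableSet_lt (h.comp (measurable_add_const _)) measurable_const

theorem ae_continuousAt_coding (φ : ℝ) :
    ∀ᵐ x : UnitAddCircle, ContinuousAt (coding φ) x := by
  have hsing : ∀ (n : ℤ) (y : UnitAddCircle),
      ∀ᵐ x : UnitAddCircle, x + n • (φ : UnitAddCircle) ≠ y := fun n y => by
    have h0 : volume {y - n • (φ : UnitAddCircle)} = 0 := by
      rw [← Metric.closedBall_zero, AddCircle.volume_closedBall]
      simp
    filter_upwards [measure_eq_zero_iff_ae_notMem.1 h0] with x hx h
    exact hx (eq_sub_of_add_eq h)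
  have hall : ∀ᵐ x : UnitAddCircle, ∀ n : ℤ,
      x + n • (φ : UnitAddCircle) ≠ 0 ∧ x + n • (φ : UnitAddCircle) ≠ φ :=
    ae_all_iff.2 fun n => (hsing n 0).and (hsing n φ)
  filter_upwards [hall] with x hx
  refine continuousAt_pi.2 fun n => ?_
  obtain ⟨h0, h1⟩ := hx n
  have hcont : ContinuousAt
      (fun x => (AddCircle.equivIco 1 0 (x + n • (φ : UnitAddCircle)) : ℝ)) x :=
    continuous_subtype_val.continuousAt.comp <|
      ContinuousAt.comp (f := fun x => x + n • (φ : UnitAddCircle))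
        (AddCircle.continuousAt_equivIco 1 0 (by simpa using h0))
        (continuous_add_const _).continuousAt
  have hne : (AddCircle.equivIco 1 0 (x + n • (φ : UnitAddCircle)) : ℝ) ≠ φ := fun h => by
    exact h1 ((AddCircle.coe_equivIco (p := 1) (a := 0)).symm.trans (congrArg _ h))
  rcases hne.lt_or_gt with hlt | hgt
  · refine (continuousAt_const (y := (0 : Fin 2))).congr ?_
    filter_upwards [hcont.eventually_lt continuousAt_const hlt] with y hy
    simp [coding, hy]
  · refine (continuousAt_const (y := (1 : Fin 2))).congr ?_
    filter_upwards [continuousAt_const.eventually_lt hcont hgt] with y hy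
    simp [coding, hy.le]

theorem ae_coding_mem_GSt {φ : ℝ} (hφ : Irrational φ) :
    ∀ᵐ x : UnitAddCircle, coding φ x ∈ GSt φ := by
  have hd : DenseRange fun k : ℤ => k • -(φ : UnitAddCircle) := by
    rw [← AddCircle.coe_neg, AddCircle.denseRange_zsmul_coe_iff]
    simpa using hφ.neg
  filter_upwards [ae_continuousAt_coding φ] with x hx
  refine closure_mono ?_ (mem_closure_image hx (hd x))
  rintro _ ⟨_, ⟨k, rfl⟩, rfl⟩
  exact ⟨k, coding_neg_zsmul φ k⟩

theorem volume_closure_preimage_coding (φ : ℝ) {C : Set (ℤ → Fin 2)} (hC : IsClosed C) :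
    volume (closure (coding φ ⁻¹' C)) = volume (coding φ ⁻¹' C) := by
  refine le_antisymm (measure_mono_ae ?_) (measure_mono subset_closure)
  filter_upwards [ae_continuousAt_coding φ] with x hx hxC
  exact closure_minimal (Set.image_preimage_subset _ _) hC (mem_closure_image hx hxC)

theorem map_shift_map_coding (φ : ℝ) :
    Measure.map (fun X (n : ℤ) => X (n - 1)) (Measure.map (coding φ) volume) =
      Measure.map (coding φ) volume := by
  rw [Measure.map_map (by fun_prop) (measurable_coding φ)]
  have h : (fun (X : ℤ → Fin 2) (n : ℤ) => X (n - 1)) ∘ coding φ =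
      coding φ ∘ (· + -(φ : UnitAddCircle)) := funext fun x => coding_sub_one φ x
  rw [h, ← Measure.map_map (measurable_coding φ) (measurable_add_const _),
    map_add_right_eq_self]

theorem measureReal_le_integral_of_coding {φ : ℝ} (hφ : Irrational φ) {μ : Measure (ℤ → Fin 2)}
    [IsProbabilityMeasure μ] (hinv : Measure.map (fun X (n : ℤ) => X (n - 1)) μ = μ)
    (hμ : μ (GSt φ) = 1) {C : Set (ℤ → Fin 2)} (hC : IsClopen C) (g : C(UnitAddCircle, ℝ))
    (hg0 : ∀ x, 0 ≤ g x) (hg : ∀ x, coding φ x ∈ C → 1 ≤ g x) :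
    μ.real C ≤ ∫ x, g x := by
  set S : (ℤ → Fin 2) → ℤ → Fin 2 := fun X n => X (n - 1) with hS
  have hSc : Continuous S := by fun_prop
  have hSμ : MeasurePreserving S μ μ := ⟨hSc.measurable, hinv⟩
  set a : UnitAddCircle := -(φ : UnitAddCircle) with ha
  have ha0 : addOrderOf a = 0 := by
    rw [← AddCircle.denseRange_zsmul_iff, ha, ← AddCircle.coe_neg,
      AddCircle.denseRange_zsmul_coe_iff]
    simpa using hφ.neg
  have hiter : ∀ (j : ℕ) x, S^[j] (coding φ x) = coding φ (x + j • a) := by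
    intro j
    induction j with
    | zero => simp
    | succ j ih =>
      intro x
      rw [Function.iterate_succ_apply, show S (coding φ x) = coding φ (x + a) from coding_sub_one φ x,
        ih, succ_nsmul', add_assoc]
  refine le_of_forall_pos_le_add fun ε hε => ?_
  have hlim := tendsto_birkhoffAverage_rotationOperator ha0
    ⟨fun x => (g x : ℂ), Complex.continuous_ofReal.comp g.continuous⟩
  obtain ⟨N, hN, hN0⟩ :=
    ((Metric.tendsto_nhds.1 hlim ε hε).and (Filter.eventually_gt_atTop 0)).exists
  have hNpos : (0 : ℝ) < N := Nat.cast_pos.2 hN0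
  have havg : ∀ x, ∑ j ∈ Finset.range N, g (x + j • a) ≤ N * ((∫ x, g x) + ε) := by
    intro x
    have h := (ContinuousMap.dist_apply_le_dist x).trans_lt hN
    rw [birkhoffAverage_rotationOperator_apply] at h
    simp only [ContinuousMap.coe_mk, ContinuousMap.const_apply, integral_complex_ofReal] at h
    rw [← Complex.ofReal_sum, ← Complex.ofReal_natCast, ← Complex.ofReal_inv, ← Complex.ofReal_mul,
      Complex.dist_of_im_eq (by simp), Complex.ofReal_re, Complex.ofReal_re, Real.dist_eq] at h
    rw [← inv_mul_le_iff₀ hNpos]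
    linarith [(abs_lt.1 h).2]
  set F : (ℤ → Fin 2) → ℝ := fun X =>
    ∑ j ∈ Finset.range N, C.indicator (fun _ => (1 : ℝ)) (S^[j] X) with hF
  have hind : Continuous (C.indicator fun _ => (1 : ℝ)) :=
    IsClopen.continuous_indicator hC continuous_const
  have hFc : Continuous F :=
    continuous_finsetSum _ fun j _ => hind.comp (hSc.iterate j)
  have hFle : ∀ X ∈ GSt φ, F X ≤ N * ((∫ x, g x) + ε) := by
    refine closure_minimal (t := {X | F X ≤ N * ((∫ x, g x) + ε)}) ?_
      (isClosed_le hFc continuous_const)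
    rintro _ ⟨k, rfl⟩
    rw [← coding_neg_zsmul]
    change F (coding φ (k • a)) ≤ _
    refine le_trans (Finset.sum_le_sum fun j _ => ?_) (havg (k • a))
    rw [hiter]
    by_cases h : coding φ (k • a + j • a) ∈ C
    · simpa [h] using hg _ h
    · simpa [h] using hg0 _
  have hint : ∀ j, ∫ X, C.indicator (fun _ => (1 : ℝ)) (S^[j] X) ∂μ = μ.real C := fun j => by
    have h := hSμ.iterate j
    rw [← (h.measureReal_preimage hC.isOpen.measurableSet.nullMeasurableSet),
      ← integral_indicator_one (h.measurable hC.isOpen.measurableSet)]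
    rfl
  have hFint : ∫ X, F X ∂μ = N * μ.real C := by
    rw [hF, integral_finsetSum]
    · simp [hint]
    · exact fun j _ => (hind.comp (hSc.iterate j)).integrable_of_hasCompactSupport
        (HasCompactSupport.of_compactSpace _)
  have hGae : ∀ᵐ X ∂μ, X ∈ GSt φ :=
    (prob_compl_eq_zero_iff isClosed_closure.measurableSet).2 hμ
  have hle : ∫ X, F X ∂μ ≤ N * ((∫ x, g x) + ε) := by
    have := integral_mono_ae
      (hFc.integrable_of_hasCompactSupport (HasCompactSupport.of_compactSpace _))
      (integrable_const (N * ((∫ x, g x) + ε))) (hGae.mono hFle)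
    simpa using this
  rw [hFint] at hle
  exact le_of_mul_le_mul_left hle hNpos

theorem measure_le_map_coding_of_isClopen {φ : ℝ} (hφ : Irrational φ) {μ : Measure (ℤ → Fin 2)}
    [IsProbabilityMeasure μ] (hinv : Measure.map (fun X (n : ℤ) => X (n - 1)) μ = μ)
    (hμ : μ (GSt φ) = 1) {C : Set (ℤ → Fin 2)} (hC : IsClopen C) :
    μ C ≤ Measure.map (coding φ) volume C := by
  rw [Measure.map_apply (measurable_coding φ) hC.isOpen.measurableSet,
    ← volume_closure_preimage_coding φ hC.isClosed]
  have hcl : IsClosed (closure (coding φ ⁻¹' C)) := isClosed_closure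
  refine ge_of_tendsto' (HasOuterApproxClosed.tendsto_lintegral_apprSeq hcl volume) fun n => ?_
  have h := measureReal_le_integral_of_coding hφ hinv hμ hC
    ⟨fun x => (hcl.apprSeq n x : ℝ), by fun_prop⟩ (fun x => NNReal.coe_nonneg _) (fun x hx => by
      have hx : x ∈ closure (coding φ ⁻¹' C) := subset_closure hx
      simp [HasOuterApproxClosed.apprSeq_apply_eq_one hcl n hx])
  rw [lintegral_coe_eq_integral, ← ofReal_measureReal]
  · exact ENNReal.ofReal_le_ofReal h
  · exact Continuous.integrable_of_hasCompactSupport (by fun_prop)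
      (HasCompactSupport.of_compactSpace _)

theorem isProbabilityMeasure_map_coding (φ : ℝ) :
    IsProbabilityMeasure (Measure.map (coding φ) volume) :=
  ⟨by rw [Measure.map_apply (measurable_coding φ) .univ, Set.preimage_univ,
    UnitAddCircle.measure_univ]⟩

theorem ext_of_le_of_isClopen {X : Type*} [TopologicalSpace X] [T2Space X] [CompactSpace X]
    [TotallyDisconnectedSpace X] [SecondCountableTopology X] [MeasurableSpace X] [BorelSpace X]
    {μ ν : Measure X} [IsProbabilityMeasure μ] [IsProbabilityMeasure ν]
    (h : ∀ C, IsClopen C → μ C ≤ ν C) : μ = ν := by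
  refine ext_of_generate_finite {C | IsClopen C}
    ((BorelSpace.measurable_eq).trans isTopologicalBasis_isClopen.borel_eq_generateFrom)
    (fun s hs t ht _ => IsClopen.inter hs ht) (fun C hC => ?_) (by simp)
  refine le_antisymm (h C hC) ?_
  have hc := h Cᶜ (IsClopen.compl hC)
  rw [prob_compl_eq_one_sub ((IsClopen.isOpen hC).measurableSet),
    prob_compl_eq_one_sub ((IsClopen.isOpen hC).measurableSet)] at hc
  exact (ENNReal.sub_le_sub_iff_left prob_le_one ENNReal.one_ne_top).1 hc

/-- For every irrational `φ ∈ (0,1)`, the Sturmian system is uniquely ergodic: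
there is exactly one shift-invariant Borel probability measure on `{0,1}^ℤ` giving full
measure to `G_St(φ)`. -/
theorem sturmian_uniquely_ergodic
    (φ : ℝ) (hφ : Irrational φ) (hφ0 : 0 < φ) (hφ1 : φ < 1) :
    ∃! μ : Measure (ℤ → Fin 2),
      IsProbabilityMeasure μ ∧
      Measure.map (fun X (n : ℤ) => X (n - 1)) μ = μ ∧
      μ (GSt φ) = 1 := by
  have hprob := isProbabilityMeasure_map_coding φ
  refine ⟨Measure.map (coding φ) volume, ⟨hprob, map_shift_map_coding φ, ?_⟩, ?_⟩
  · have hm : MeasurableSet (GSt φ) := isClosed_closure.measurableSet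
    rw [← prob_compl_eq_zero_iff hm]
    exact (ae_map_iff (measurable_coding φ).aemeasurable hm).2
      (ae_coding_mem_GSt hφ)
  · rintro μ ⟨_, hinv, hμ⟩
    exact ext_of_le_of_isClopen fun C hC => measure_le_map_coding_of_isClopen hφ hinv hμ hC
end

section
/- For every irrational φ ∈ (0,1), the Sturmian sequence X^φ satisfies the Strict Boundary Condition: for every k ≥ 1 and every pattern ar : {0,…,k−1} → {0,1} there exist a frequency ω_ar ∈ [0,1] and a constant C_ar > 0 such that for every a ∈ ℤ and every L ≥ k, |n_ar(a,L) − ω_ar·L| < C_ar, where n_ar(a,L) = #{j : a ≤ j ≤ a+L−k and X^φ(j+i) = ar(i) for all 0 ≤ i ≤ k−1} is the number of occurrences of ar in the window {a,…,a+L−1}. -/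
/-- The number of occurrences of the pattern `ar : Fin k → Fin 2` in the window
`{a, …, a+L−1}` of the configuration `X`. -/
noncomputable def occCount (X : ℤ → Fin 2) {k : ℕ} (ar : Fin k → Fin 2) (a : ℤ) (L : ℕ) : ℕ :=
  ((Finset.Icc a (a + (L : ℤ) - (k : ℤ))).filter
    (fun j => ∀ i : Fin k, X (j + (i : ℤ)) = ar i)).card

/-- The sequences whose window sums deviate from a linear function of the window length by a
bounded amount, uniformly in the position of the window. -/
def balancedSequences : Submodule ℝ (ℤ → ℝ) where
  carrier := {f | ∃ ω C : ℝ, ∀ (a : ℤ) (N : ℕ),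
    |∑ n ∈ Finset.range N, f (a + n) - ω * N| ≤ C}
  zero_mem' := ⟨0, 0, fun a N => by simp⟩
  add_mem' := by
    rintro f g ⟨ω, C, hf⟩ ⟨ω', C', hg⟩
    refine ⟨ω + ω', C + C', fun a N => ?_⟩
    have h : ∑ n ∈ Finset.range N, (f + g) (a + n) - (ω + ω') * N =
        (∑ n ∈ Finset.range N, f (a + n) - ω * N) +
          (∑ n ∈ Finset.range N, g (a + n) - ω' * N) := by
      simp only [Pi.add_apply, Finset.sum_add_distrib]
      ring
    rw [h]
    exact (abs_add_le _ _).trans (add_le_add (hf a N) (hg a N))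
  smul_mem' := by
    rintro c f ⟨ω, C, hf⟩
    refine ⟨c * ω, |c| * C, fun a N => ?_⟩
    have h : ∑ n ∈ Finset.range N, (c • f) (a + n) - c * ω * N =
        c * (∑ n ∈ Finset.range N, f (a + n) - ω * N) := by
      simp only [Pi.smul_apply, smul_eq_mul, ← Finset.mul_sum]
      ring
    rw [h, abs_mul]
    exact mul_le_mul_of_nonneg_left (hf a N) (abs_nonneg c)

lemma const_mem_balancedSequences (c : ℝ) : (fun _ => c) ∈ balancedSequences :=
  ⟨c, 0, fun a N => by simp [mul_comm]⟩

lemma shift_sub_mem_balancedSequences {u : ℤ → ℝ} {K : ℝ} (hu : ∀ n, |u n| ≤ K) (i : ℤ) :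
    (fun j => u (j + i) - u j) ∈ balancedSequences := by
  have step : ∀ i : ℤ, (fun j => u (j + i + 1) - u (j + i)) ∈ balancedSequences := by
    refine fun i => ⟨0, K + K, fun a N => ?_⟩
    have h : ∑ n ∈ Finset.range N, (u (a + n + i + 1) - u (a + n + i)) =
        u (a + N + i) - u (a + i) := by
      induction N with
      | zero => simp
      | succ N ih =>
        rw [Finset.sum_range_succ, ih]
        push_cast
        rw [show a + ((N : ℤ) + 1) + i = a + N + i + 1 by ring]
        ring
    rw [zero_mul, sub_zero, h]
    exact (abs_sub _ _).trans (add_le_add (hu _) (hu _))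
  induction i with
  | zero =>
    simp only [add_zero, sub_self]
    exact const_mem_balancedSequences 0
  | succ i ih =>
    convert balancedSequences.add_mem ih (step i) using 1
    ext j
    simp [add_assoc]
  | pred i ih =>
    convert balancedSequences.sub_mem ih (step (-i - 1)) using 1
    ext j
    simp only [Pi.sub_apply]
    rw [show j + (-(i : ℤ) - 1) + 1 = j + -i by ring]
    ring

lemma frequency_mem_Icc_of_abs_sum_sub_le {f : ℤ → ℝ} {ω C : ℝ} (hf0 : ∀ j, 0 ≤ f j)
    (hf1 : ∀ j, f j ≤ 1)
    (h : ∀ (a : ℤ) (N : ℕ), |∑ n ∈ Finset.range N, f (a + n) - ω * N| ≤ C) :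
    ω ∈ Set.Icc 0 1 := by
  have hs0 : ∀ N : ℕ, 0 ≤ ∑ n ∈ Finset.range N, f (0 + n) :=
    fun N => Finset.sum_nonneg fun n _ => hf0 _
  have hs1 : ∀ N : ℕ, ∑ n ∈ Finset.range N, f (0 + n) ≤ N := fun N => by
    simpa using Finset.sum_le_sum (s := Finset.range N) fun n _ => hf1 (0 + n)
  constructor <;> by_contra! hω
  · obtain ⟨N, hN⟩ := exists_lt_nsmul (neg_pos.mpr hω) C
    rw [nsmul_eq_mul] at hN
    linarith [le_abs_self (∑ n ∈ Finset.range N, f (0 + n) - ω * N), h 0 N, hs0 N]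
  · obtain ⟨N, hN⟩ := exists_lt_nsmul (sub_pos.mpr hω) C
    rw [nsmul_eq_mul] at hN
    linarith [neg_abs_le (∑ n ∈ Finset.range N, f (0 + n) - ω * N), h 0 N, hs1 N]

/-- The carry in the addition modulo one of `j * φ` and `i * φ`. -/
noncomputable def rotationCarry (φ : ℝ) (i j : ℤ) : ℝ :=
  if 1 ≤ Int.fract (i * φ) + Int.fract (j * φ) then 1 else 0

lemma rotationCarry_eq (φ : ℝ) (i j : ℤ) :
    rotationCarry φ i j =
      Int.fract (i * φ) - (Int.fract (((j + i : ℤ) : ℝ) * φ) - Int.fract (j * φ)) := by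
  have h1 := Int.fract_nonneg ((i : ℝ) * φ)
  have h2 := Int.fract_lt_one ((i : ℝ) * φ)
  have h3 := Int.fract_nonneg ((j : ℝ) * φ)
  have h4 := Int.fract_lt_one ((j : ℝ) * φ)
  have e1 := Int.floor_add_fract ((i : ℝ) * φ)
  have e2 := Int.floor_add_fract ((j : ℝ) * φ)
  unfold rotationCarry
  split_ifs with h
  · have : Int.fract (((j + i : ℤ) : ℝ) * φ) =
        Int.fract (i * φ) + Int.fract (j * φ) - 1 := by
      refine Int.fract_eq_iff.mpr ⟨by linarith, by linarith,
        ⌊(i : ℝ) * φ⌋ + ⌊(j : ℝ) * φ⌋ + 1, ?_⟩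
      push_cast
      linarith
    linarith
  · have : Int.fract (((j + i : ℤ) : ℝ) * φ) = Int.fract (i * φ) + Int.fract (j * φ) := by
      refine Int.fract_eq_iff.mpr ⟨by linarith, by linarith,
        ⌊(i : ℝ) * φ⌋ + ⌊(j : ℝ) * φ⌋, ?_⟩
      push_cast
      linarith
    linarith

lemma rotationCarry_mem_balancedSequences (φ : ℝ) (i : ℤ) :
    rotationCarry φ i ∈ balancedSequences := by
  have hu : ∀ n : ℤ, |Int.fract ((n : ℝ) * φ)| ≤ 1 := fun n => by
    rw [Int.abs_fract]
    exact (Int.fract_lt_one _).le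
  convert balancedSequences.sub_mem (const_mem_balancedSequences (Int.fract (i * φ)))
    (shift_sub_mem_balancedSequences hu i) using 1
  ext j
  exact rotationCarry_eq φ i j

lemma rotationCarry_mul_of_le {φ : ℝ} {i i' : ℤ}
    (h : Int.fract ((i : ℝ) * φ) ≤ Int.fract (i' * φ)) :
    rotationCarry φ i * rotationCarry φ i' = rotationCarry φ i := by
  ext j
  simp only [Pi.mul_apply, rotationCarry]
  split_ifs <;> linarith

/-- The submonoid formed by the constant sequence `1` and all carry sequences. -/
def rotationCarrySubmonoid (φ : ℝ) : Submonoid (ℤ → ℝ) where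
  carrier := insert 1 (Set.range (rotationCarry φ))
  one_mem' := Set.mem_insert _ _
  mul_mem' := by
    rintro _ _ (rfl | ⟨i, rfl⟩) (rfl | ⟨i', rfl⟩)
    · simp
    · simp
    · simp
    · rcases le_total (Int.fract ((i : ℝ) * φ)) (Int.fract (i' * φ)) with h | h
      · rw [rotationCarry_mul_of_le h]
        exact Or.inr ⟨i, rfl⟩
      · rw [mul_comm, rotationCarry_mul_of_le h]
        exact Or.inr ⟨i', rfl⟩

lemma mem_balancedSequences_of_mem_adjoin {φ : ℝ} {f : ℤ → ℝ}
    (hf : f ∈ Algebra.adjoin ℝ (rotationCarrySubmonoid φ : Set (ℤ → ℝ))) :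
    f ∈ balancedSequences := by
  rw [← Subalgebra.mem_toSubmodule, Algebra.adjoin_eq_span, Submonoid.closure_eq] at hf
  refine Submodule.span_le.mpr ?_ hf
  rintro _ (rfl | ⟨i, rfl⟩)
  · exact const_mem_balancedSequences 1
  · exact rotationCarry_mem_balancedSequences φ i

lemma sturmian_zero_indicator_eq {φ : ℝ} (hφ0 : 0 < φ) (hφ1 : φ < 1) (n : ℤ) :
    (if sturmian φ n = 0 then (1 : ℝ) else 0) =
      φ - Int.fract (n * φ) + Int.fract (((n - 1 : ℤ) : ℝ) * φ) := by
  have h1 := Int.fract_nonneg ((n : ℝ) * φ)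
  have h2 := Int.fract_lt_one ((n : ℝ) * φ)
  have e1 := Int.floor_add_fract ((n : ℝ) * φ)
  unfold sturmian
  by_cases h : Int.fract ((n : ℝ) * φ) < φ
  · have : Int.fract (((n - 1 : ℤ) : ℝ) * φ) = Int.fract (n * φ) - φ + 1 := by
      refine Int.fract_eq_iff.mpr ⟨by linarith, by linarith, ⌊(n : ℝ) * φ⌋ - 1, ?_⟩
      push_cast
      linarith
    rw [this, if_pos h, if_pos rfl]
    ring
  · have : Int.fract (((n - 1 : ℤ) : ℝ) * φ) = Int.fract (n * φ) - φ := by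
      refine Int.fract_eq_iff.mpr ⟨by linarith, by linarith, ⌊(n : ℝ) * φ⌋, ?_⟩
      push_cast
      linarith
    rw [this, if_neg h, if_neg (by decide)]
    ring

lemma sturmian_zero_indicator_mem_adjoin {φ : ℝ} (hφ0 : 0 < φ) (hφ1 : φ < 1) (i : ℤ) :
    (fun j => if sturmian φ (j + i) = 0 then (1 : ℝ) else 0) ∈
      Algebra.adjoin ℝ (rotationCarrySubmonoid φ : Set (ℤ → ℝ)) := by
  have hc : ∀ m, rotationCarry φ m ∈
      Algebra.adjoin ℝ (rotationCarrySubmonoid φ : Set (ℤ → ℝ)) :=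
    fun m => Algebra.subset_adjoin (Or.inr ⟨m, rfl⟩)
  convert add_mem (sub_mem (hc i) (hc (i - 1))) (Subalgebra.algebraMap_mem _
    (φ - Int.fract (i * φ) + Int.fract (((i - 1 : ℤ) : ℝ) * φ))) using 1
  ext j
  simp only [Pi.add_apply, Pi.sub_apply, Pi.algebraMap_apply, Algebra.algebraMap_self,
    RingHom.id_apply]
  rw [sturmian_zero_indicator_eq hφ0 hφ1, rotationCarry_eq, rotationCarry_eq,
    show j + (i - 1) = j + i - 1 by ring]
  ring

lemma sturmian_indicator_mem_adjoin {φ : ℝ} (hφ0 : 0 < φ) (hφ1 : φ < 1) (i : ℤ) (s : Fin 2) :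
    (fun j => if sturmian φ (j + i) = s then (1 : ℝ) else 0) ∈
      Algebra.adjoin ℝ (rotationCarrySubmonoid φ : Set (ℤ → ℝ)) := by
  have h0 := sturmian_zero_indicator_mem_adjoin hφ0 hφ1 i
  obtain rfl | rfl : s = 0 ∨ s = 1 := by omega
  · exact h0
  · convert sub_mem (one_mem _) h0 using 1
    ext j
    obtain h | h : sturmian φ (j + i) = 0 ∨ sturmian φ (j + i) = 1 := by omega
    all_goals simp [h]

lemma sturmian_pattern_indicator_mem_balancedSequences {φ : ℝ} (hφ0 : 0 < φ) (hφ1 : φ < 1)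
    {k : ℕ} (ar : Fin k → Fin 2) :
    (fun j => if ∀ i : Fin k, sturmian φ (j + (i : ℤ)) = ar i then (1 : ℝ) else 0) ∈
      balancedSequences := by
  apply mem_balancedSequences_of_mem_adjoin (φ := φ)
  convert prod_mem (t := Finset.univ) fun (i : Fin k) _ =>
    sturmian_indicator_mem_adjoin hφ0 hφ1 (i : ℤ) (ar i) using 1
  ext j
  simp [Finset.prod_apply, Finset.prod_ite_zero]

lemma occCount_eq_sum (X : ℤ → Fin 2) {k : ℕ} (ar : Fin k → Fin 2) (a : ℤ) {L : ℕ}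
    (hL : k ≤ L) :
    (occCount X ar a L : ℝ) = ∑ n ∈ Finset.range (L - k + 1),
      if ∀ i : Fin k, X (a + n + (i : ℤ)) = ar i then 1 else 0 := by
  rw [occCount, Finset.card_filter]
  push_cast
  symm
  refine Finset.sum_bij (fun n _ => a + (n : ℤ)) ?_ ?_ ?_ (fun _ _ => rfl)
  · intro n hn
    rw [Finset.mem_range] at hn
    rw [Finset.mem_Icc]
    omega
  · intro n _ m _ h
    omega
  · intro j hj
    rw [Finset.mem_Icc] at hj
    refine ⟨(j - a).toNat, ?_, ?_⟩
    · rw [Finset.mem_range]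
      omega
    · omega

/-- Every Sturmian sequence satisfies the Strict Boundary Condition: for
each finite pattern `ar` there are a frequency `ω_ar ∈ [0,1]` and a constant `C_ar > 0` such
that the number of occurrences of `ar` in any window of `L ≥ k` consecutive sites differs
from `ω_ar·L` by less than `C_ar`. -/
theorem sturmian_strict_boundary_condition
    (φ : ℝ) (hφ : Irrational φ) (hφ0 : 0 < φ) (hφ1 : φ < 1) :
    ∀ k : ℕ, 1 ≤ k → ∀ ar : Fin k → Fin 2,
      ∃ ω : ℝ, 0 ≤ ω ∧ ω ≤ 1 ∧ ∃ C : ℝ, 0 < C ∧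
        ∀ a : ℤ, ∀ L : ℕ, k ≤ L →
          |(occCount (sturmian φ) ar a L : ℝ) - ω * (L : ℝ)| < C := by
  intro k hk ar
  obtain ⟨ω, C, h⟩ := sturmian_pattern_indicator_mem_balancedSequences hφ0 hφ1 ar
  obtain ⟨hω0, hω1⟩ := frequency_mem_Icc_of_abs_sum_sub_le
    (f := fun j => if ∀ i : Fin k, sturmian φ (j + (i : ℤ)) = ar i then (1 : ℝ) else 0)
    (fun j => ite_nonneg zero_le_one le_rfl) (fun j => ite_le_one le_rfl zero_le_one) h
  have hC : 0 ≤ C := (abs_nonneg _).trans (h 0 0)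
  refine ⟨ω, hω0, hω1, C + k, by positivity, fun a L hL => ?_⟩
  rw [occCount_eq_sum _ _ _ hL]
  have hN := abs_le.mp (h a (L - k + 1))
  push_cast [Nat.cast_sub hL] at hN
  have hk' : (1 : ℝ) ≤ k := by exact_mod_cast hk
  have h0 : 0 ≤ ω * ((k : ℝ) - 1) := mul_nonneg hω0 (by linarith)
  have h1 : ω * ((k : ℝ) - 1) ≤ 1 * (k - 1) := mul_le_mul_of_nonneg_right hω1 (by linarith)
  rw [abs_lt]
  constructor <;> linarith
end

section
/- For φ = 2/(1+√5) = (√5−1)/2, the Sturmian sequence coincides (up to a shift) with the Fibonacci sequence produced by the substitution 0 → 01, 1 → 0: if s ∈ {0,1}^ℕ denotes the unique fixed point of this substitution starting with 0 (s = 0,1,0,0,1,0,1,0,0,1,…), then for every n ≥ 0, s(n) = 0 if and only if the fractional part {(n+2)φ} lies in [0,φ), i.e. s(n) = X^φ(n+2). -/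
/-- The Fibonacci substitution `0 ↦ 01`, `1 ↦ 0`. -/
def fibSub : Fin 2 → List (Fin 2) :=
  fun x => if x = 0 then [0, 1] else [0]

/-- The starting position of the `n`-th substitution block in the substituted infinite word:
`Σ_{i<n} |fibSub (s i)|`. -/
def blockStart (s : ℕ → Fin 2) (n : ℕ) : ℕ :=
  ∑ i ∈ Finset.range n, (fibSub (s i)).length

/-- `s` is a fixed point of the Fibonacci substitution: the infinite word `s` equals the
concatenation `fibSub (s 0) ++ fibSub (s 1) ++ ⋯`. -/
def IsFibFixedPoint (s : ℕ → Fin 2) : Prop :=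
  ∀ n : ℕ, ∀ j : ℕ, j < (fibSub (s n)).length →
    s (blockStart s n + j) = (fibSub (s n)).getD j 0

theorem fibSub_length_zero : (fibSub 0).length = 2 := rfl

theorem fibSub_length_of_ne_zero {a : Fin 2} (ha : a ≠ 0) : (fibSub a).length = 1 := by
  simp [fibSub, ha]

theorem blockStart_succ (s : ℕ → Fin 2) (n : ℕ) :
    blockStart s (n + 1) = blockStart s n + (fibSub (s n)).length :=
  Finset.sum_range_succ _ _

theorem lt_blockStart_succ {s : ℕ → Fin 2} (h0 : s 0 = 0) (n : ℕ) :
    n + 1 < blockStart s (n + 1) := by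
  induction n with
  | zero => simp [blockStart, h0, fibSub]
  | succ n ih =>
    rw [blockStart_succ]
    by_cases h : s (n + 1) = 0
    · rw [h, fibSub_length_zero]; omega
    · rw [fibSub_length_of_ne_zero h]; omega

/-- For `0 < φ < 1`, the fractional part of `x + φ` is less than `φ` exactly when the integer part
increases by one in passing from `x` to `x + φ`. -/
theorem fract_add_lt_iff_floor_add {φ : ℝ} (hpos : 0 < φ) (hlt : φ < 1) (x : ℝ) :
    (Int.fract (x + φ) < φ → ⌊x + φ⌋ = ⌊x⌋ + 1) ∧
      (¬ Int.fract (x + φ) < φ → ⌊x + φ⌋ = ⌊x⌋) := by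
  have h1 := Int.floor_le x
  have h2 := Int.lt_floor_add_one x
  have h3 := Int.floor_le (x + φ)
  have h4 := Int.lt_floor_add_one (x + φ)
  unfold Int.fract
  constructor
  · intro h
    apply le_antisymm
    · have : ((⌊x + φ⌋ : ℤ) : ℝ) < ((⌊x⌋ + 2 : ℤ) : ℝ) := by push_cast; linarith
      have := Int.cast_lt.mp this
      omega
    · have : ((⌊x⌋ : ℤ) : ℝ) < ((⌊x + φ⌋ : ℤ) : ℝ) := by linarith
      exact Int.cast_lt.mp this
  · intro h
    exact (Int.floor_eq_iff.mpr ⟨by linarith, by linarith⟩).symm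

/-- If the zeros of `s` before position `n` are those of the shifted Sturmian sequence, then the
`n`-th block starts at `n + ⌊(n + 1) φ⌋`. -/
theorem blockStart_eq_add_floor {φ : ℝ} (hpos : 0 < φ) (hlt : φ < 1) {s : ℕ → Fin 2} {n : ℕ}
    (hs : ∀ i < n, (s i = 0 ↔ Int.fract (((i : ℝ) + 2) * φ) < φ)) :
    (blockStart s n : ℤ) = n + ⌊((n : ℝ) + 1) * φ⌋ := by
  induction n with
  | zero =>
    have : ⌊φ⌋ = 0 := Int.floor_eq_zero_iff.mpr ⟨hpos.le, hlt⟩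
    simp [blockStart, this]
  | succ n ih =>
    have ih := ih fun i hi => hs i (by omega)
    have hn := hs n (by omega)
    have hf := fract_add_lt_iff_floor_add hpos hlt (((n : ℝ) + 1) * φ)
    rw [show ((n : ℝ) + 1) * φ + φ = ((n : ℝ) + 2) * φ by ring] at hf
    rw [blockStart_succ]
    push_cast
    rw [ih, show (n : ℝ) + 1 + 1 = n + 2 by ring]
    by_cases h : s n = 0
    · rw [hf.1 (hn.mp h), h, fibSub_length_zero]; push_cast; ring
    · rw [hf.2 (mt hn.mpr h), fibSub_length_of_ne_zero h]; push_cast; ring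

theorem Irrational.natCast_mul_ne_natCast {φ : ℝ} (hirr : Irrational φ) {m : ℕ} (hm : m ≠ 0)
    (k : ℕ) : (m : ℝ) * φ ≠ k :=
  (hirr.natCast_mul hm).ne_nat k

/-- The positions of the zeros of a fixed point of the Fibonacci substitution starting with `0`. -/
theorem IsFibFixedPoint.eq_zero_iff_fract_lt {φ : ℝ} (hpos : 0 < φ) (hlt : φ < 1)
    (hirr : Irrational φ) (hφ : φ ^ 2 + φ = 1) {s : ℕ → Fin 2} (hfix : IsFibFixedPoint s)
    (h0 : s 0 = 0) (n : ℕ) : s n = 0 ↔ Int.fract (((n : ℝ) + 2) * φ) < φ := by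
  suffices H : ∀ n, ∀ i < blockStart s n, (s i = 0 ↔ Int.fract (((i : ℝ) + 2) * φ) < φ) from
    H (n + 1) n (by have := lt_blockStart_succ h0 n; omega)
  intro n
  induction n with
  | zero => simp [blockStart]
  | succ n ih =>
    have hprev : ∀ i < n, (s i = 0 ↔ Int.fract (((i : ℝ) + 2) * φ) < φ) := by
      intro i hi
      obtain ⟨k, rfl⟩ := Nat.exists_eq_add_of_lt hi
      exact ih i (by have := lt_blockStart_succ h0 (i + k); omega)
    have hstart := blockStart_eq_add_floor hpos hlt hprev
    set B := blockStart s n with hB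
    have hfloor : ⌊((n : ℝ) + 1) * φ⌋ = (B : ℤ) - n := by omega
    obtain ⟨hle, hgt⟩ := Int.floor_eq_iff.mp hfloor
    push_cast at hle hgt
    -- Multiplying by `φ` and using `φ * (1 + φ) = 1` turns these into bounds on `(B + 1) * φ`.
    have hlower : ((B : ℝ) + 1) * φ < n + 1 := by
      have hne : ((B : ℝ) + 1) * φ ≠ n + 1 := by
        exact_mod_cast hirr.natCast_mul_ne_natCast (Nat.succ_ne_zero B) (n + 1)
      refine lt_of_le_of_ne ?_ hne
      nlinarith
    have hupper : (n : ℝ) + 1 < ((B : ℝ) + 2) * φ := by nlinarith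
    have hfirst : s B = 0 ↔ Int.fract (((B : ℝ) + 2) * φ) < φ := by
      have hpos_len : 0 < (fibSub (s n)).length := by
        unfold fibSub; split <;> simp
      have hsB : s B = 0 := by
        have := hfix n 0 hpos_len
        rw [← hB, add_zero] at this
        rw [this]
        unfold fibSub; split <;> rfl
      have hfl : ⌊((B : ℝ) + 2) * φ⌋ = (n : ℤ) + 1 :=
        Int.floor_eq_iff.mpr ⟨by push_cast; linarith, by push_cast; linarith⟩
      refine iff_of_true hsB ?_
      rw [Int.fract, hfl]
      push_cast
      linarith
    intro i hi
    rw [blockStart_succ, ← hB] at hi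
    by_cases hiB : i < B
    · exact ih i hiB
    by_cases hiB' : i = B
    · rw [hiB']; exact hfirst
    by_cases hn : s n = 0
    swap
    · rw [fibSub_length_of_ne_zero hn] at hi; omega
    rw [hn, fibSub_length_zero] at hi
    obtain rfl : i = B + 1 := by omega
    have hsi : s (B + 1) = 1 := by
      have := hfix n 1 (by rw [hn, fibSub_length_zero]; omega)
      rw [← hB, hn] at this
      exact this
    have hnfract : Int.fract (((n : ℝ) + 2) * φ) < φ := by
      rcases Nat.eq_zero_or_pos n with rfl | hnpos
      · have hB0 : B = 0 := by simp [hB, blockStart]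
        simpa [hB0] using hfirst.mp (by rw [hB0, h0])
      · obtain ⟨k, rfl⟩ := Nat.exists_eq_add_of_lt hnpos
        exact (ih _ (by have := lt_blockStart_succ h0 (0 + k); omega)).mp hn
    have hf := (fract_add_lt_iff_floor_add hpos hlt (((n : ℝ) + 1) * φ)).1
    rw [show ((n : ℝ) + 1) * φ + φ = ((n : ℝ) + 2) * φ by ring, hfloor] at hf
    have hle' := (Int.floor_eq_iff.mp (hf hnfract)).1
    push_cast at hle'
    have hlt' : ((B : ℝ) + 3) * φ < n + 2 := by
      have hne : ((B : ℝ) + 3) * φ ≠ n + 2 := by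
        exact_mod_cast hirr.natCast_mul_ne_natCast (Nat.succ_ne_zero (B + 2)) (n + 2)
      refine lt_of_le_of_ne ?_ hne
      nlinarith
    have hfl : ⌊((B : ℝ) + 3) * φ⌋ = (n : ℤ) + 1 :=
      Int.floor_eq_iff.mpr ⟨by push_cast; linarith, by push_cast; linarith⟩
    refine iff_of_false (by simp [hsi]) ?_
    push_cast
    rw [show (B : ℝ) + 1 + 2 = B + 3 by ring, Int.fract, hfl]
    push_cast
    linarith

theorem two_div_one_add_sqrt_five : 2 / (1 + √5 : ℝ) = (√5 - 1) / 2 := by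
  have h5 : (√5 : ℝ) ^ 2 = 5 := Real.sq_sqrt (by norm_num)
  have hne : (1 + √5 : ℝ) ≠ 0 := by positivity
  field_simp
  linarith

/-- For `φ = 2/(1+√5) = (√5−1)/2`, the fixed point `s` of the Fibonacci
substitution starting with `0` coincides with a shift of the Sturmian sequence:
`s(n) = X^φ(n+2)` for all `n ≥ 0`; in particular `s(n) = 0` iff the fractional part of
`(n+2)·φ` lies in `[0,φ)`. -/
theorem fibonacci_fixed_point_eq_shifted_sturmian
    (s : ℕ → Fin 2) (hfix : IsFibFixedPoint s) (h0 : s 0 = 0) :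
    ∀ n : ℕ, s n = sturmian (2 / (1 + Real.sqrt 5)) ((n : ℤ) + 2) ∧
      (s n = 0 ↔ Int.fract ((((n : ℤ) + 2 : ℤ) : ℝ) * ((Real.sqrt 5 - 1) / 2))
        ∈ Set.Ico (0 : ℝ) ((Real.sqrt 5 - 1) / 2)) := by
  intro n
  have h5 : (√5 : ℝ) ^ 2 = 5 := Real.sq_sqrt (by norm_num)
  have hsqrt0 : (0 : ℝ) ≤ √5 := Real.sqrt_nonneg 5
  have hirr : Irrational ((√5 - 1) / 2) := by
    have h : Irrational (√5 : ℝ) := by exact_mod_cast Nat.Prime.irrational_sqrt Nat.prime_five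
    exact_mod_cast (h.sub_natCast 1).div_natCast (m := 2) (by norm_num)
  have key := hfix.eq_zero_iff_fract_lt (φ := (√5 - 1) / 2) (by nlinarith) (by nlinarith) hirr
    (by nlinarith) h0 n
  rw [two_div_one_add_sqrt_five]
  constructor
  · unfold sturmian
    push_cast
    split_ifs with h
    · exact key.mpr h
    · have := mt key.mp h
      omega
  · push_cast
    rw [key, Set.mem_Ico]
    exact (and_iff_right (Int.fract_nonneg _)).symm
end
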